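/- Let d ≥ 3 be odd, ℓ a positive integer and ε > 0. There exists a constant C = C(ε,ℓ,d) > 0 such that the following holds: for every pure field K = ℚ(a^{1/d}) of degree d, writing a = ∏_{i=1}^{d−1} A_i^i with A_1,…,A_{d−1} positive, squarefree and pairwise coprime integers, one has #Cl_K[ℓ] ≤ C · D_K^{1/2+ε} · ( min over integers m with (d+1)/2 ≤ m ≤ d−1 of ∏_{i=1}^{d−1} A_i^{ (i·m)/d − ⌊(i·m)/d⌋ } )^{−1/ℓ}. -/

import Mathlib

open NumberField Polynomial

/-- The denominator ideal of `α ∈ K`: the set of `x ∈ 𝓞 K` with `x·α ∈ 𝓞 K`.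
Its absolute norm is the non-archimedean part `∏_v max(1,|α|_v)^{d_v}` of the height. -/
noncomputable def denIdeal (K : Type*) [Field K] [NumberField K] (α : K) : Ideal (𝓞 K) where
  carrier := {x : 𝓞 K | ∃ y : 𝓞 K, (x : K) * α = (y : K)}
  zero_mem' := ⟨0, by simp⟩
  add_mem' := by
    rintro a b ⟨ya, ha⟩ ⟨yb, hb⟩
    exact ⟨ya + yb, by push_cast; rw [add_mul, ha, hb]⟩
  smul_mem' := by
    rintro c x ⟨y, hy⟩
    exact ⟨c * y, by rw [smul_eq_mul]; push_cast; rw [mul_assoc, hy]⟩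

/-- The relative multiplicative Weil height `H_K(α) = ∏_{v ∈ M_K} max(1,|α|_v)^{d_v}`. -/
noncomputable def heightK (K : Type*) [Field K] [NumberField K] (α : K) : ℝ :=
  (Ideal.absNorm (denIdeal K α) : ℝ) * ∏ w : InfinitePlace K, max 1 (w α) ^ w.mult

/-- `N'_K(X)`: the number of `α ∈ K` with `ℚ(α) = K` and `H_K(α) < X`. -/
noncomputable def NprimeK (K : Type*) [Field K] [NumberField K] (X : ℝ) : ℕ :=
  Nat.card {α : K // IntermediateField.adjoin ℚ {α} = ⊤ ∧ heightK K α < X}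

/-- `M_{K,ℓ} = inf_{X > 0} X^{-1/ℓ}(1 + N'_K(X))`. -/
noncomputable def MKl (K : Type*) [Field K] [NumberField K] (ℓ : ℕ) : ℝ :=
  ⨅ X : {X : ℝ // 0 < X}, (X : ℝ) ^ (-(1:ℝ)/ℓ) * (1 + (NprimeK K X : ℝ))

/-- `η(K)`: the minimal height of a primitive element of `K`. -/
noncomputable def etaK (K : Type*) [Field K] [NumberField K] : ℝ :=
  sInf {x : ℝ | ∃ α : K, IntermediateField.adjoin ℚ {α} = ⊤ ∧ heightK K α = x}

/-- `D_K`: the absolute value of the discriminant. -/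
noncomputable def DK (K : Type*) [Field K] [NumberField K] : ℕ :=
  (NumberField.discr K).natAbs

section PrimesInResidueClass

open ArithmeticFunction.vonMangoldt Filter Topology

variable {q : ℕ} {a : ZMod q}

/-- The weights `log p / p` on the primes `p ≡ a` modulo `q`. -/
noncomputable def primeWeight (a : ZMod q) (n : ℕ) : ℝ :=
  (if n.Prime then residueClass a n else 0) / n

lemma primeWeight_nonneg (n : ℕ) : 0 ≤ primeWeight a n := by
  unfold primeWeight
  have := residueClass_nonneg a n
  positivity

lemma primeWeight_zero : primeWeight a 0 = 0 := by simp [primeWeight]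

lemma tsum_residueClass_eq [NeZero q] (ha : IsUnit a) {x : ℝ} (hx : 1 < x) :
    ∑' n, residueClass a n / (n : ℝ) ^ x =
      (LFunctionResidueClassAux a x).re + (q.totient : ℝ)⁻¹ / (x - 1) := by
  refine Complex.ofReal_injective ?_
  simp only [Complex.ofReal_tsum, Complex.ofReal_div, Complex.ofReal_cpow (Nat.cast_nonneg _),
    Complex.ofReal_natCast, Complex.ofReal_add, Complex.ofReal_inv, Complex.ofReal_sub,
    Complex.ofReal_one]
  simp_rw [← LFunctionResidueClassAux_real ha hx,
    eqOn_LFunctionResidueClassAux ha <| Set.mem_ofPred.mpr (Complex.ofReal_re x ▸ hx),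
    sub_add_cancel, LSeries, LSeries.term]
  refine tsum_congr fun n ↦ ?_
  split_ifs with hn
  · simp only [hn, residueClass_apply_zero, Complex.ofReal_zero, zero_div]
  · rfl

lemma div_natCast_rpow_one_add {f : ℕ → ℝ} (n : ℕ) {σ : ℝ} (hσ : 0 < σ) :
    f n / n * (n : ℝ) ^ (-σ) = f n / (n : ℝ) ^ (1 + σ) := by
  rcases n.eq_zero_or_pos with rfl | hn
  · simp [Real.zero_rpow (show 1 + σ ≠ 0 by positivity)]
  · have : (0 : ℝ) < n := by exact_mod_cast hn
    rw [Real.rpow_add this, Real.rpow_one, Real.rpow_neg this.le]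
    field_simp

lemma summable_residueClass_mul_rpow {σ : ℝ} (hσ : 0 < σ) :
    Summable fun n : ℕ ↦ residueClass a n / n * (n : ℝ) ^ (-σ) := by
  simp_rw [div_natCast_rpow_one_add (f := residueClass a) _ hσ]
  exact LSeries.summable_real_of_abscissaOfAbsConv_lt <|
        (abscissaOfAbsConv_residueClass_le_one a).trans_lt <| mod_cast (by linarith : 1 < 1 + σ)

lemma natCast_rpow_neg_le_one (n : ℕ) {σ : ℝ} (hσ : 0 < σ) : (n : ℝ) ^ (-σ) ≤ 1 := by
  rcases n.eq_zero_or_pos with rfl | hn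
  · simp [Real.zero_rpow (show -σ ≠ 0 by linarith)]
  · exact Real.rpow_le_one_of_one_le_of_nonpos (by exact_mod_cast hn) (by linarith)

lemma summable_primeWeight {σ : ℝ} (hσ : 0 < σ) :
    Summable fun n : ℕ ↦ primeWeight a n * (n : ℝ) ^ (-σ) := by
  refine Summable.of_nonneg_of_le (fun n ↦ ?_) (fun n ↦ ?_)
    (summable_residueClass_mul_rpow (a := a) hσ)
  · exact mul_nonneg (primeWeight_nonneg n) (by positivity)
  · unfold primeWeight
    have := residueClass_nonneg a n
    gcongr
    split_ifs <;> simp [this]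

lemma tsum_primeWeight_bound [NeZero q] (ha : IsUnit a) :
    ∃ C : ℝ, ∀ σ ∈ Set.Ioc (0 : ℝ) 1,
      |∑' n, primeWeight a n * (n : ℝ) ^ (-σ) - (q.totient : ℝ)⁻¹ / σ| ≤ C := by
  have : ContinuousOn (fun x : ℝ ↦ (LFunctionResidueClassAux a x).re) (Set.Icc 1 2) :=
    Complex.continuous_re.continuousOn.comp (t := Set.univ)
      (continuousOn_LFunctionResidueClassAux a)
      (fun ⦃x⦄ a ↦ trivial) |>.comp Complex.continuous_ofReal.continuousOn fun x hx ↦ by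
        simpa only [Set.mem_ofPred_eq, Complex.ofReal_re] using hx.1
  obtain ⟨C, hC⟩ := isCompact_Icc.exists_bound_of_continuousOn this
  set T := ∑' n : ℕ, (if n.Prime then 0 else residueClass a n) / (n : ℝ) with hT
  refine ⟨C + T, fun σ hσ ↦ ?_⟩
  have hσ0 := hσ.1
  have hnp (n : ℕ) : 0 ≤ (if n.Prime then 0 else residueClass a n) / (n : ℝ) := by
    have := residueClass_nonneg a n
    positivity
  have hle (n : ℕ) : (if n.Prime then 0 else residueClass a n) / (n : ℝ) * (n : ℝ) ^ (-σ) ≤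
      (if n.Prime then 0 else residueClass a n) / (n : ℝ) :=
    mul_le_of_le_one_right (hnp n) (natCast_rpow_neg_le_one n hσ0)
  have hnp' (n : ℕ) :
      0 ≤ (if n.Prime then 0 else residueClass a n) / (n : ℝ) * (n : ℝ) ^ (-σ) :=
    mul_nonneg (hnp n) (by positivity)
  have hs1 : Summable fun n : ℕ ↦
      (if n.Prime then 0 else residueClass a n) / (n : ℝ) * (n : ℝ) ^ (-σ) :=
    Summable.of_nonneg_of_le hnp' hle (summable_residueClass_non_primes_div a)
  have h1 : ∑' n : ℕ, (if n.Prime then 0 else residueClass a n) / (n : ℝ) * (n : ℝ) ^ (-σ) ≤ T :=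
    hs1.tsum_le_tsum hle (summable_residueClass_non_primes_div a)
  have h2 : 0 ≤ ∑' n : ℕ, (if n.Prime then 0 else residueClass a n) / (n : ℝ) * (n : ℝ) ^ (-σ) :=
    tsum_nonneg hnp'
  have h3 : ∑' n, residueClass a n / n * (n : ℝ) ^ (-σ) =
      ∑' n : ℕ, primeWeight a n * (n : ℝ) ^ (-σ) +
      ∑' n : ℕ, (if n.Prime then 0 else residueClass a n) / (n : ℝ) * (n : ℝ) ^ (-σ) := by
    rw [← (summable_primeWeight hσ0).tsum_add hs1]
    refine tsum_congr fun n ↦ ?_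
    unfold primeWeight
    split_ifs <;> simp
  have h4 := tsum_residueClass_eq ha (x := 1 + σ) (by linarith)
  simp_rw [← div_natCast_rpow_one_add (f := residueClass a) _ hσ0] at h4
  have h5 := hC (1 + σ) ⟨by linarith, by linarith [hσ.2]⟩
  rw [Real.norm_eq_abs] at h5
  rw [add_sub_cancel_left] at h4
  rw [abs_le] at h5 ⊢
  constructor <;> linarith [h5.1, h5.2]

lemma tendsto_mul_tsum_primeWeight [NeZero q] (ha : IsUnit a) (k : ℕ) :
    Tendsto (fun σ : ℝ ↦ σ * ∑' n, primeWeight a n * (n : ℝ) ^ (-((k + 1) * σ))) (𝓝[>] 0)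
      (𝓝 ((q.totient : ℝ)⁻¹ * (1 / (k + 1)))) := by
  obtain ⟨C, hC⟩ := tsum_primeWeight_bound ha
  rw [tendsto_iff_norm_sub_tendsto_zero]
  have hk : (0 : ℝ) < k + 1 := by positivity
  have hlim : Tendsto (fun σ : ℝ ↦ σ * C) (𝓝[>] 0) (𝓝 0) := by
    have : Tendsto (fun σ : ℝ ↦ σ * C) (𝓝 0) (𝓝 (0 * C)) := tendsto_id.mul_const C
    rw [zero_mul] at this
    exact this.mono_left nhdsWithin_le_nhds
  refine squeeze_zero' (Eventually.of_forall fun _ ↦ norm_nonneg _) ?_ hlim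
  filter_upwards [Ioc_mem_nhdsGT (show (0 : ℝ) < 1 / (k + 1) by positivity)] with σ hσ
  have hσ0 := hσ.1
  have := hC ((k + 1) * σ) ⟨by positivity, by
    have := hσ.2
    rw [le_div_iff₀ hk] at this
    linarith⟩
  rw [Real.norm_eq_abs, show (q.totient : ℝ)⁻¹ * (1 / (k + 1)) =
    σ * ((q.totient : ℝ)⁻¹ / ((k + 1) * σ)) by field_simp, ← mul_sub, abs_mul, abs_of_pos hσ0]
  gcongr

lemma primeWeight_mul_pow (n k : ℕ) {σ : ℝ} :
    primeWeight a n * (n : ℝ) ^ (-((k + 1) * σ)) =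
      primeWeight a n * (n : ℝ) ^ (-σ) * ((n : ℝ) ^ (-σ)) ^ k := by
  rcases n.eq_zero_or_pos with rfl | hn
  · simp [primeWeight_zero]
  · have : (0 : ℝ) < n := by exact_mod_cast hn
    rw [← Real.rpow_natCast, ← Real.rpow_mul this.le, mul_assoc, ← Real.rpow_add this]
    ring_nf

lemma summable_primeWeight_mul_eval (P : ℝ[X]) {σ : ℝ} (hσ : 0 < σ) :
    Summable fun n : ℕ ↦ primeWeight a n * (n : ℝ) ^ (-σ) * P.eval ((n : ℝ) ^ (-σ)) := by
  simp_rw [eval_eq_sum_range, Finset.mul_sum]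
  refine summable_sum fun k _ ↦ ?_
  have := (summable_primeWeight (a := a) (σ := (k + 1) * σ) (by positivity)).mul_left (P.coeff k)
  refine this.congr fun n ↦ ?_
  rw [primeWeight_mul_pow]
  ring

lemma tendsto_mul_tsum_primeWeight_eval [NeZero q] (ha : IsUnit a) (P : ℝ[X]) :
    Tendsto (fun σ : ℝ ↦
      σ * ∑' n : ℕ, primeWeight a n * (n : ℝ) ^ (-σ) * P.eval ((n : ℝ) ^ (-σ))) (𝓝[>] 0)
      (𝓝 ((q.totient : ℝ)⁻¹ * ∫ x in (0 : ℝ)..1, P.eval x)) := by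
  have hint : ∫ x in (0 : ℝ)..1, P.eval x =
      ∑ k ∈ Finset.range (P.natDegree + 1), P.coeff k * (1 / (k + 1)) := by
    simp_rw [eval_eq_sum_range]
    rw [intervalIntegral.integral_finsetSum]
    · refine Finset.sum_congr rfl fun k _ ↦ ?_
      rw [intervalIntegral.integral_const_mul, integral_pow]
      simp
    · intro k _
      exact (by fun_prop : Continuous fun x : ℝ ↦ P.coeff k * x ^ k).intervalIntegrable _ _
  rw [hint, Finset.mul_sum]
  have := tendsto_finsetSum (Finset.range (P.natDegree + 1)) fun k _ ↦
    (tendsto_mul_tsum_primeWeight ha k).const_mul (P.coeff k)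
  refine (this.congr' ?_).trans_eq ?_
  · filter_upwards [self_mem_nhdsWithin] with σ hσ
    have hσ : 0 < σ := hσ
    have hs (k : ℕ) : Summable fun n : ℕ ↦
        P.coeff k * (primeWeight a n * (n : ℝ) ^ (-((k + 1) * σ))) :=
      (summable_primeWeight (a := a) (σ := (k + 1) * σ) (by positivity)).mul_left _
    simp_rw [eval_eq_sum_range, Finset.mul_sum]
    have h1 : ∀ k n : ℕ, primeWeight a n * (n : ℝ) ^ (-σ) * (P.coeff k * ((n : ℝ) ^ (-σ)) ^ k) =
        P.coeff k * (primeWeight a n * (n : ℝ) ^ (-((k + 1) * σ))) := fun k n ↦ by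
      rw [primeWeight_mul_pow]; ring
    simp_rw [h1]
    rw [Summable.tsum_finsetSum fun k _ ↦ hs k, Finset.mul_sum]
    refine Finset.sum_congr rfl fun k _ ↦ ?_
    rw [tsum_mul_left]
    ring
  · congr 1
    refine Finset.sum_congr rfl fun k _ ↦ ?_
    ring

/-- A polynomial with positive integral over `[0, 1]` which is dominated there by the
characteristic function of a given subinterval. -/
lemma exists_polynomial_le_indicator {α β : ℝ} (hα : 0 < α) (hαβ : α < β) (hβ : β < 1) :
    ∃ P : ℝ[X], 0 < ∫ x in (0 : ℝ)..1, P.eval x ∧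
      ∀ x ∈ Set.Icc (0 : ℝ) 1, P.eval x ≤ (Set.Icc α β).indicator 1 x := by
  set g : ℝ → ℝ := fun x ↦ max 0 ((x - α) * (β - x)) with hg
  have hgc : Continuous g := by fun_prop
  have hI : 0 < ∫ x in (0 : ℝ)..1, g x :=
    intervalIntegral.integral_pos one_pos hgc.continuousOn (fun x _ ↦ le_max_left _ _)
      ⟨(α + β) / 2, ⟨by linarith, by linarith⟩, lt_max_of_lt_right
        (mul_pos (by linarith) (by linarith))⟩
  set η := (∫ x in (0 : ℝ)..1, g x) / 3 with hη
  have hη0 : 0 < η := by positivity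
  obtain ⟨P, hP⟩ := exists_polynomial_near_of_continuousOn 0 1 g hgc.continuousOn η hη0
  refine ⟨P - C η, ?_, fun x hx ↦ ?_⟩
  · have : ∫ x in (0 : ℝ)..1, (g x - 2 * η) ≤ ∫ x in (0 : ℝ)..1, (P - C η).eval x := by
      refine intervalIntegral.integral_mono_on zero_le_one
        ((by fun_prop : Continuous fun x ↦ g x - 2 * η).intervalIntegrable _ _)
        ((P - C η).continuous.intervalIntegrable _ _) fun x hx ↦ ?_
      have := abs_lt.1 (hP x hx)
      simp only [eval_sub, eval_C]
      linarith
    rw [intervalIntegral.integral_sub (hgc.intervalIntegrable _ _)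
      (continuous_const.intervalIntegrable _ _), intervalIntegral.integral_const] at this
    simp only [sub_zero, one_smul] at this
    linarith
  · have h1 := abs_lt.1 (hP x hx)
    simp only [eval_sub, eval_C]
    have h2 : P.eval x - η ≤ g x := by linarith
    refine h2.trans ?_
    by_cases hx' : x ∈ Set.Icc α β
    · rw [Set.indicator_of_mem hx']
      refine max_le zero_le_one ?_
      simp only [Pi.one_apply]
      nlinarith [hx'.1, hx'.2]
    · rw [Set.indicator_of_notMem hx']
      refine max_le le_rfl ?_
      rw [Set.mem_Icc, not_and_or, not_le, not_le] at hx'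
      rcases hx' with h | h
      · exact mul_nonpos_of_nonpos_of_nonneg (by linarith) (by linarith)
      · exact mul_nonpos_of_nonneg_of_nonpos (by linarith) (by linarith)

/-- A lower bound for the number of primes in a residue class. -/
theorem exists_le_card_primes_residueClass [NeZero q] (ha : IsUnit a) {ε : ℝ}
    (hε : 0 < ε) (hε1 : ε < 1) :
    ∃ c : ℝ, 0 < c ∧ ∀ Z : ℝ, 0 < Z → c * Z ^ (1 - ε) ≤
      1 + (((Finset.range (⌊Z⌋₊ + 1)).filter fun p : ℕ ↦ p.Prime ∧ (p : ZMod q) = a).card : ℝ) := by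
  obtain ⟨P, hP0, hP⟩ := exists_polynomial_le_indicator (α := Real.exp (-1))
    (β := Real.exp (-(1 - ε))) (Real.exp_pos _) (Real.exp_lt_exp.2 (by linarith))
    (Real.exp_lt_one_iff.2 (by linarith))
  have hφ : (0 : ℝ) < (q.totient : ℝ)⁻¹ := inv_pos.mpr (mod_cast q.totient.pos_of_neZero)
  set c₀ := (q.totient : ℝ)⁻¹ * (∫ x in (0 : ℝ)..1, P.eval x) / 2 with hc₀
  have hc₀pos : 0 < c₀ := by positivity
  have hev := (tendsto_mul_tsum_primeWeight_eval ha P).eventually_const_le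
    (show c₀ < _ by rw [hc₀]; exact half_lt_self (by positivity))
  have hlog : Tendsto (fun Z : ℝ ↦ (Real.log Z)⁻¹) atTop (𝓝[>] 0) :=
    tendsto_inv_atTop_nhdsGT_zero.comp Real.tendsto_log_atTop
  obtain ⟨Z₀, hZ₀⟩ := eventually_atTop.1 ((hlog.eventually hev).and (eventually_gt_atTop 1))
  have key : ∀ Z ≥ Z₀, c₀ * Z ^ (1 - ε) ≤
      (((Finset.range (⌊Z⌋₊ + 1)).filter fun p : ℕ ↦ p.Prime ∧ (p : ZMod q) = a).card : ℝ) := by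
    intro Z hZ
    obtain ⟨h1, hZ1⟩ := hZ₀ Z hZ
    have hZpos : 0 < Z := by linarith
    have hL : 0 < Real.log Z := Real.log_pos hZ1
    set σ := (Real.log Z)⁻¹ with hσ
    have hσ0 : 0 < σ := inv_pos.2 hL
    set s := (Finset.range (⌊Z⌋₊ + 1)).filter fun p : ℕ ↦ p.Prime ∧ (p : ZMod q) = a with hs
    have hZε : 0 < Z ^ (1 - ε) := by positivity
    have hterm (n : ℕ) : primeWeight a n * (n : ℝ) ^ (-σ) * P.eval ((n : ℝ) ^ (-σ)) ≤
        if n ∈ s then Real.log Z / Z ^ (1 - ε) else 0 := by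
      have hw := primeWeight_nonneg (a := a) n
      have hx0 : (0 : ℝ) ≤ (n : ℝ) ^ (-σ) := by positivity
      have hx1 := natCast_rpow_neg_le_one n hσ0
      have hle : primeWeight a n * (n : ℝ) ^ (-σ) * P.eval ((n : ℝ) ^ (-σ)) ≤
          primeWeight a n * (n : ℝ) ^ (-σ) *
          (Set.Icc (Real.exp (-1)) (Real.exp (-(1 - ε)))).indicator 1 ((n : ℝ) ^ (-σ)) := by
        gcongr
        exact hP _ ⟨hx0, hx1⟩
      refine hle.trans ?_
      have hrhs : (0 : ℝ) ≤ if n ∈ s then Real.log Z / Z ^ (1 - ε) else 0 := by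
        split_ifs
        · positivity
        · exact le_rfl
      by_cases hn : n.Prime ∧ (n : ZMod q) = a
      swap
      · have : primeWeight a n = 0 := by
          unfold primeWeight
          rcases not_and_or.1 hn with h | h
          · simp [h]
          · simp [residueClass, Set.indicator, h]
        rw [this]
        simpa using hrhs
      by_cases hmem : (n : ℝ) ^ (-σ) ∈ Set.Icc (Real.exp (-1)) (Real.exp (-(1 - ε)))
      swap
      · rw [Set.indicator_of_notMem hmem, mul_zero]
        exact hrhs
      have hnpos : (0 : ℝ) < n := by exact_mod_cast hn.1.pos
      rw [Real.rpow_def_of_pos hnpos, Set.mem_Icc, Real.exp_le_exp, Real.exp_le_exp, hσ,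
        mul_neg, neg_le_neg_iff, neg_le_neg_iff, ← div_eq_mul_inv, div_le_one hL,
        le_div_iff₀ hL] at hmem
      have hnZ : (n : ℝ) ≤ Z := (Real.log_le_log_iff hnpos hZpos).1 hmem.1
      have hnZ' : Z ^ (1 - ε) ≤ n := by
        rw [← Real.log_le_log_iff hZε hnpos, Real.log_rpow hZpos]
        exact hmem.2
      have hns : n ∈ s := by
        rw [hs, Finset.mem_filter, Finset.mem_range, Nat.lt_succ_iff]
        exact ⟨Nat.le_floor hnZ, hn⟩
      rw [if_pos hns]
      have hwle : primeWeight a n ≤ Real.log Z / Z ^ (1 - ε) := by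
        unfold primeWeight
        rw [if_pos hn.1]
        have h2 : residueClass a n ≤ Real.log Z :=
          (residueClass_le a n).trans (ArithmeticFunction.vonMangoldt_le_log.trans hmem.1)
        gcongr
      have hind : (Set.Icc (Real.exp (-1)) (Real.exp (-(1 - ε)))).indicator (1 : ℝ → ℝ)
          ((n : ℝ) ^ (-σ)) ≤ 1 := Set.indicator_le_self' (fun _ _ ↦ zero_le_one) _
      calc _ ≤ primeWeight a n * (n : ℝ) ^ (-σ) * 1 := by gcongr
        _ ≤ primeWeight a n * 1 * 1 := by gcongr
        _ ≤ _ := by simpa using hwle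
    have hsum : ∑' n : ℕ, primeWeight a n * (n : ℝ) ^ (-σ) * P.eval ((n : ℝ) ^ (-σ)) ≤
        s.card * (Real.log Z / Z ^ (1 - ε)) := by
      refine (Summable.tsum_le_tsum hterm (summable_primeWeight_mul_eval P hσ0)
        (summable_of_ne_finset_zero (s := s) fun n hn ↦ if_neg hn)).trans_eq ?_
      rw [tsum_eq_sum (s := s) fun n hn ↦ if_neg hn,
        Finset.sum_congr rfl fun n hn ↦ if_pos hn, Finset.sum_const, nsmul_eq_mul]
    have h3 : c₀ ≤ σ * (s.card * (Real.log Z / Z ^ (1 - ε))) := h1.trans (by gcongr)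
    have h4 : σ * (s.card * (Real.log Z / Z ^ (1 - ε))) = s.card / Z ^ (1 - ε) := by
      rw [hσ]; field_simp
    rw [h4, le_div_iff₀ hZε] at h3
    exact h3
  have hZ₀1 : 1 < Z₀ := (hZ₀ Z₀ le_rfl).2
  have hZ₀p : 0 < Z₀ ^ (1 - ε) := by positivity
  refine ⟨min c₀ (Z₀ ^ (1 - ε))⁻¹, lt_min hc₀pos (inv_pos.2 hZ₀p), fun Z hZ ↦ ?_⟩
  rcases le_or_gt Z₀ Z with h | h
  · calc _ ≤ c₀ * Z ^ (1 - ε) := by gcongr; exact min_le_left _ _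
      _ ≤ _ := key Z h
      _ ≤ _ := by linarith
  · calc _ ≤ (Z₀ ^ (1 - ε))⁻¹ * Z₀ ^ (1 - ε) := by
          gcongr
          exact min_le_right _ _
      _ = 1 := inv_mul_cancel₀ hZ₀p.ne'
      _ ≤ _ := by
        have : (0 : ℝ) ≤ (((Finset.range (⌊Z⌋₊ + 1)).filter
          fun p : ℕ ↦ p.Prime ∧ (p : ZMod q) = a).card : ℝ) := Nat.cast_nonneg _
        linarith

end PrimesInResidueClass

section IdealCount

open Ideal

theorem card_le_finrank_of_forall_natCast_mem {K : Type*} [Field K] [NumberField K] {p : ℕ}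
    (hp : p.Prime) (s : Finset (Ideal (𝓞 K)))
    (hs : ∀ P ∈ s, P.IsPrime ∧ (p : 𝓞 K) ∈ P) : s.card ≤ Module.finrank ℚ K := by
  have hp0 : (p : 𝓞 K) ≠ 0 := Nat.cast_ne_zero.2 hp.ne_zero
  have hne : ∀ P ∈ s, P ≠ ⊥ := by
    rintro P hP rfl
    exact hp0 (by simpa using (hs _ hP).2)
  have hdvd : ∏ P ∈ s, P ∣ span {(p : 𝓞 K)} :=
    Finset.prod_primes_dvd _ (fun P hP ↦ by
      have := (hs P hP).1
      exact prime_of_isPrime (hne P hP) this)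
      fun P hP ↦ dvd_span_singleton.2 (hs P hP).2
  have h1 : ∏ P ∈ s, absNorm P ∣ p ^ Module.finrank ℚ K := by
    rw [← map_prod, ← RingOfIntegers.rank, ← absNorm_span_natCast]
    exact map_dvd absNorm hdvd
  have h2 : p ^ s.card ∣ ∏ P ∈ s, absNorm P := by
    rw [← Finset.prod_const]
    refine Finset.prod_dvd_prod_of_dvd _ _ fun P hP ↦ ?_
    have h := (hs P hP).1
    have := absNorm_dvd_absNorm_of_le ((span_singleton_le_iff_mem P).2 (hs P hP).2)
    rw [absNorm_span_natCast, Nat.dvd_prime_pow hp] at this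
    obtain ⟨k, -, hk⟩ := this
    rw [hk]
    refine dvd_pow_self _ ?_
    rintro rfl
    exact h.ne_top (absNorm_eq_one_iff.1 (by simpa using hk))
  exact (Nat.pow_dvd_pow_iff_le_right hp.one_lt).1 (h2.trans h1)

theorem exists_index_injOn_primes (K : Type*) [Field K] [NumberField K] :
    ∃ idx : Ideal (𝓞 K) → Fin (Module.finrank ℚ K), ∀ p : ℕ, p.Prime → ∀ P Q : Ideal (𝓞 K),
      P.IsPrime → Q.IsPrime → (p : 𝓞 K) ∈ P → (p : 𝓞 K) ∈ Q → idx P = idx Q → P = Q := by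
  classical
  have : Nonempty (Fin (Module.finrank ℚ K)) := ⟨⟨0, Module.finrank_pos⟩⟩
  let T : ℕ → Set (Ideal (𝓞 K)) := fun p ↦ {P | P.IsPrime ∧ (p : 𝓞 K) ∈ P}
  have hT : ∀ p, p.Prime → ∃ f : Ideal (𝓞 K) → Fin (Module.finrank ℚ K), Set.InjOn f (T p) := by
    intro p hp
    have hfin : (T p).Finite := by
      by_contra h
      obtain ⟨s, hs, hc⟩ := Set.Infinite.exists_subset_card_eq h (Module.finrank ℚ K + 1)
      have := card_le_finrank_of_forall_natCast_mem hp s fun P hP ↦ hs hP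
      omega
    have hc := card_le_finrank_of_forall_natCast_mem hp hfin.toFinset
      fun P hP ↦ hfin.mem_toFinset.1 hP
    have hle : (T p).encard ≤ (Set.univ : Set (Fin (Module.finrank ℚ K))).encard := by
      rw [hfin.encard_eq_coe_toFinset_card, Set.encard_univ]
      simpa using hc
    obtain ⟨f, -, hf⟩ := hfin.exists_injOn_of_encard_le hle
    exact ⟨f, hf⟩
  choose! f hf using hT
  refine ⟨fun P ↦ f (absNorm (under ℤ P)) P, fun p hp P Q hP hQ hpP hpQ h ↦ ?_⟩
  have key : ∀ P : Ideal (𝓞 K), P.IsPrime → (p : 𝓞 K) ∈ P → absNorm (under ℤ P) = p := by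
    intro P hP hpP
    have : NeZero P := ⟨by rintro rfl; exact hp.ne_zero (by simpa using hpP)⟩
    have h1 := Nat.absNorm_under_prime P
    have h2 : ((p : ℤ) : 𝓞 K) ∈ P := by simpa using hpP
    rw [Int.cast_mem_ideal_iff, Int.natCast_dvd_natCast] at h2
    exact (Nat.prime_dvd_prime_iff_eq h1 hp).1 h2
  simp only [key P hP hpP, key Q hQ hpQ] at h
  exact hf p hp ⟨hP, hpP⟩ ⟨hQ, hpQ⟩ h


theorem factorization_prod_absNorm_filter {K : Type*} [Field K] [NumberField K]
    {idx : Ideal (𝓞 K) → Fin (Module.finrank ℚ K)}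
    (hidx : ∀ p : ℕ, p.Prime → ∀ P Q : Ideal (𝓞 K),
      P.IsPrime → Q.IsPrime → (p : 𝓞 K) ∈ P → (p : 𝓞 K) ∈ Q → idx P = idx Q → P = Q)
    {P : Ideal (𝓞 K)} (hP : P.IsPrime) {p : ℕ} (hp : p.Prime) (hpP : (p : 𝓞 K) ∈ P)
    [DecidableEq (Ideal (𝓞 K))]
    (s : Multiset (Ideal (𝓞 K))) (hs : ∀ Q ∈ s, Q.IsPrime ∧ Q ≠ ⊥) :
    ((s.filter (idx · = idx P)).map absNorm).prod.factorization p =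
      s.count P * (absNorm P).factorization p := by
  induction s using Multiset.induction with
  | empty => simp
  | cons Q s ih =>
    have hQ := hs Q (Multiset.mem_cons_self _ _)
    have hs' := fun R hR ↦ hs R (Multiset.mem_cons_of_mem hR)
    specialize ih hs'
    have hQ0 : absNorm Q ≠ 0 := absNorm_eq_zero_iff.not.2 hQ.2
    have hprod : ((s.filter (idx · = idx P)).map absNorm).prod ≠ 0 := by
      rw [Ne, Multiset.prod_eq_zero_iff]
      simp only [Multiset.mem_map, not_exists, not_and]
      exact fun R hR ↦ absNorm_eq_zero_iff.not.2 (hs' R (Multiset.mem_of_mem_filter hR)).2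
    by_cases hi : idx Q = idx P
    · rw [Multiset.filter_cons_of_pos (p := (idx · = idx P)) _ hi, Multiset.map_cons, Multiset.prod_cons,
        Nat.factorization_mul hQ0 hprod, Finsupp.add_apply, ih]
      by_cases hPQ : Q = P
      · subst hPQ
        rw [Multiset.count_cons_self]
        ring
      · rw [Multiset.count_cons_of_ne (Ne.symm hPQ)]
        suffices (absNorm Q).factorization p = 0 by omega
        refine Nat.factorization_eq_zero_of_not_dvd fun hdvd ↦ hPQ ?_
        obtain ⟨q, n, hn, hq, hqp, h⟩ :=
          have := hQ.1.isMaximal hQ.2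
          exists_prime_and_absNorm_eq_pow Q
        rw [h] at hdvd
        obtain rfl := (Nat.prime_dvd_prime_iff_eq hp hqp).1 (hp.dvd_of_dvd_pow hdvd)
        exact hidx p hp Q P hQ.1 hP hq hpP hi
    · rw [Multiset.filter_cons_of_neg (p := (idx · = idx P)) _ hi, ih, Multiset.count_cons_of_ne]
      rintro rfl
      exact hi rfl

theorem exists_injOn_pi_nat_absNorm (K : Type*) [Field K] [NumberField K] :
    ∃ F : Ideal (𝓞 K) → Fin (Module.finrank ℚ K) → ℕ, Set.InjOn F {I | I ≠ ⊥} ∧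
      ∀ I ≠ ⊥, ∏ k, F I k = absNorm I := by
  classical
  obtain ⟨idx, hidx⟩ := exists_index_injOn_primes K
  have hprime : ∀ I : Ideal (𝓞 K), ∀ Q ∈ UniqueFactorizationMonoid.normalizedFactors I,
      Q.IsPrime ∧ Q ≠ ⊥ := fun I Q hQ ↦ by
    have := UniqueFactorizationMonoid.prime_of_normalized_factor Q hQ
    exact ⟨isPrime_of_prime this, this.ne_zero⟩
  refine ⟨fun I k ↦ (((UniqueFactorizationMonoid.normalizedFactors I).filter
    (idx · = k)).map absNorm).prod, fun I hI J hJ h ↦ ?_, fun I hI ↦ ?_⟩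
  · rw [← Ideal.prod_normalizedFactors_eq_self hI, ← Ideal.prod_normalizedFactors_eq_self hJ]
    congr 1
    ext P
    by_cases hP : P ∈ UniqueFactorizationMonoid.normalizedFactors I ∨
        P ∈ UniqueFactorizationMonoid.normalizedFactors J
    · have hPp : P.IsPrime ∧ P ≠ ⊥ := hP.elim (hprime I P) (hprime J P)
      obtain ⟨p, n, hn, hpP, hp, hN⟩ :=
        have := hPp.1.isMaximal hPp.2
        exists_prime_and_absNorm_eq_pow P
      have h1 := congr_arg (fun n : ℕ ↦ n.factorization p) (congr_fun h (idx P))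
      simp only [factorization_prod_absNorm_filter hidx hPp.1 hp hpP _ (hprime _)] at h1
      refine Nat.eq_of_mul_eq_mul_right ?_ h1
      rw [hN, hp.factorization_pow]
      simpa using hn
    · push Not at hP
      rw [Multiset.count_eq_zero_of_notMem hP.1, Multiset.count_eq_zero_of_notMem hP.2]
  · conv_rhs => rw [← Ideal.prod_normalizedFactors_eq_self hI, map_multiset_prod]
    beta_reduce
    generalize UniqueFactorizationMonoid.normalizedFactors I = s
    induction s using Multiset.induction with
    | empty => simp
    | cons Q s ih =>
      have : ∀ k, (((Q ::ₘ s).filter (idx · = k)).map absNorm).prod =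
          (if idx Q = k then absNorm Q else 1) * ((s.filter (idx · = k)).map absNorm).prod := by
        intro k
        split_ifs with h
        · rw [Multiset.filter_cons_of_pos (p := (idx · = k)) _ h, Multiset.map_cons, Multiset.prod_cons]
        · rw [Multiset.filter_cons_of_neg (p := (idx · = k)) _ h, one_mul]
      simp_rw [this]
      rw [Finset.prod_mul_distrib, ih, Finset.prod_ite_eq]
      simp

/-- The number of nonzero ideals of norm at most `Y` is `O(Y ^ (1 + ε))`, with an implied constant
that depends only on `ε` and the degree. -/
theorem exists_card_ideal_absNorm_le (d : ℕ) {ε : ℝ} (hε : 0 < ε) :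
    ∃ C : ℝ, 0 < C ∧ ∀ (K : Type) [Field K] [NumberField K], Module.finrank ℚ K = d →
      ∀ Y : ℝ, 0 < Y → ∀ T : Finset (Ideal (𝓞 K)),
        (∀ I ∈ T, I ≠ ⊥ ∧ (absNorm I : ℝ) ≤ Y) → (T.card : ℝ) ≤ C * Y ^ (1 + ε) := by
  classical
  have hsum : Summable fun n : ℕ ↦ ((n : ℝ) ^ (1 + ε))⁻¹ :=
    Real.summable_nat_rpow_inv.2 (by linarith)
  have hnn : ∀ n : ℕ, 0 ≤ ((n : ℝ) ^ (1 + ε))⁻¹ := fun n ↦ by positivity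
  have hpos : 0 < ∑' n : ℕ, ((n : ℝ) ^ (1 + ε))⁻¹ := hsum.tsum_pos hnn 1 (by simp)
  refine ⟨(∑' n : ℕ, ((n : ℝ) ^ (1 + ε))⁻¹) ^ d, pow_pos hpos d, ?_⟩
  rintro K _ _ rfl Y hY T hT
  obtain ⟨F, hF, hprod⟩ := exists_injOn_pi_nat_absNorm K
  set s : Finset ℕ := T.biUnion fun I ↦ Finset.univ.image (F I)
  have h1 : ∑ I ∈ T, ∏ k, ((F I k : ℝ) ^ (1 + ε))⁻¹ ≤
      ∑ f ∈ Fintype.piFinset fun _ : Fin (Module.finrank ℚ K) ↦ s,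
        ∏ k, ((f k : ℝ) ^ (1 + ε))⁻¹ := by
    rw [← Finset.sum_image (g := F) (f := fun f ↦ ∏ k, ((f k : ℝ) ^ (1 + ε))⁻¹)
      (hF.mono fun I hI ↦ (hT I hI).1)]
    refine Finset.sum_le_sum_of_subset_of_nonneg (fun f hf ↦ ?_)
      fun f _ _ ↦ Finset.prod_nonneg fun k _ ↦ hnn _
    obtain ⟨I, hI, rfl⟩ := Finset.mem_image.1 hf
    refine Fintype.mem_piFinset.2 fun k ↦ Finset.mem_biUnion.2 ⟨I, hI, ?_⟩
    exact Finset.mem_image_of_mem _ (Finset.mem_univ k)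
  rw [← Finset.prod_univ_sum (f := fun _ (n : ℕ) ↦ ((n : ℝ) ^ (1 + ε))⁻¹), Finset.prod_const,
    Finset.card_univ, Fintype.card_fin] at h1
  have h2 : (T.card : ℝ) * (Y ^ (1 + ε))⁻¹ ≤ ∑ I ∈ T, ∏ k, ((F I k : ℝ) ^ (1 + ε))⁻¹ := by
    rw [← nsmul_eq_mul, ← Finset.sum_const]
    refine Finset.sum_le_sum fun I hI ↦ ?_
    rw [Finset.prod_inv_distrib, Real.finsetProd_rpow _ _ fun k _ ↦ Nat.cast_nonneg _,
      ← Nat.cast_prod, hprod I (hT I hI).1]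
    have : (0 : ℝ) < absNorm I := Nat.cast_pos.2
      (Nat.pos_of_ne_zero (absNorm_eq_zero_iff.not.2 (hT I hI).1))
    gcongr
    exact (hT I hI).2
  have h3 := h2.trans h1
  rw [← div_eq_mul_inv, div_le_iff₀ (by positivity)] at h3
  refine h3.trans ?_
  gcongr
  exact hsum.sum_le_tsum s fun n _ ↦ hnn n

end IdealCount

section Minkowski

open mixedEmbedding InfinitePlace Ideal nonZeroDivisors

variable {K : Type*} [Field K] [NumberField K]

theorem minkowskiBound_mk0_le (J : Ideal (𝓞 K)) (hJ : J ≠ ⊥) :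
    minkowskiBound K (FractionalIdeal.mk0 K ⟨J, mem_nonZeroDivisors_of_ne_zero hJ⟩) ≤
      ENNReal.ofReal (2 ^ Module.finrank ℚ K * √|discr K| * absNorm J) := by
  rw [minkowskiBound, volume_fundamentalDomain_fractionalIdealLatticeBasis,
    volume_fundamentalDomain_latticeBasis, mixedEmbedding.finrank, FractionalIdeal.coe_mk0,
    FractionalIdeal.coeIdeal_absNorm, ENNReal.ofReal_mul (by positivity),
    ENNReal.ofReal_mul (by positivity), ENNReal.ofReal_pow (by positivity),
    mul_comm (ENNReal.ofReal _ * _)]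
  have h1 : (2 : ENNReal)⁻¹ ^ nrComplexPlaces K ≤ 1 := pow_le_one₀ (by positivity) (by simp)
  have h2 : ((NNReal.sqrt ‖discr K‖₊ : NNReal) : ENNReal) = ENNReal.ofReal √|discr K| := by
    rw [← ENNReal.ofReal_coe_nnreal, Real.coe_sqrt, coe_nnnorm, Int.norm_eq_abs]
  calc _ ≤ 2 ^ Module.finrank ℚ K * (ENNReal.ofReal ((absNorm J : ℚ) : ℝ) *
          (1 * ((NNReal.sqrt ‖discr K‖₊ : NNReal) : ENNReal))) := by gcongr
    _ = _ := ?_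
  rw [h2]
  simp
  ring

theorem exists_mem_ideal_forall_infinitePlace_lt (J : Ideal (𝓞 K)) (hJ : J ≠ ⊥)
    (f : InfinitePlace K → ℝ) (hf : ∀ w, 0 < f w)
    (h : 2 ^ Module.finrank ℚ K * √|discr K| * absNorm J < ∏ w, f w ^ w.mult) :
    ∃ x ∈ J, x ≠ 0 ∧ ∀ w : InfinitePlace K, w x < f w := by
  classical
  have key : minkowskiBound K (FractionalIdeal.mk0 K ⟨J, mem_nonZeroDivisors_of_ne_zero hJ⟩) <
      MeasureTheory.volume (convexBodyLT K fun w ↦ (f w).toNNReal) := by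
    refine (minkowskiBound_mk0_le J hJ).trans_lt ?_
    rw [convexBodyLT_volume]
    have h1 : ENNReal.ofReal (2 ^ Module.finrank ℚ K * √|discr K| * absNorm J) <
        ((∏ w, (f w).toNNReal ^ w.mult : NNReal) : ENNReal) := by
      rw [← ENNReal.ofReal_coe_nnreal, ENNReal.ofReal_lt_ofReal_iff']
      have : ((∏ w, (f w).toNNReal ^ w.mult : NNReal) : ℝ) = ∏ w, f w ^ w.mult := by
        push_cast
        exact Finset.prod_congr rfl fun w _ ↦ by rw [Real.coe_toNNReal _ (hf w).le]
      rw [this]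
      exact ⟨h, Finset.prod_pos fun w _ ↦ pow_pos (hf w) _⟩
    refine h1.trans_le (le_mul_of_one_le_left (by positivity) ?_)
    exact_mod_cast one_le_convexBodyLTFactor K
  obtain ⟨x, hx, hx0, hlt⟩ := exists_ne_zero_mem_ideal_lt K _ key
  rw [FractionalIdeal.coe_mk0, FractionalIdeal.mem_coeIdeal] at hx
  obtain ⟨y, hy, rfl⟩ := hx
  exact ⟨y, hy, fun h ↦ hx0 (by simp [h]), fun w ↦ by
    simpa [Real.coe_toNNReal _ (hf w).le] using hlt w⟩

theorem exists_primitive_element_infinitePlace_le (hodd : Odd (Module.finrank ℚ K)) :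
    ∃ x : 𝓞 K, IntermediateField.adjoin ℚ {(x : K)} = ⊤ ∧
      ∀ w : InfinitePlace K, w x ≤ 2 ^ Module.finrank ℚ K * √|discr K| + 1 := by
  have hr : 0 < nrRealPlaces K := by
    by_contra! h
    have := card_add_two_mul_card_eq_rank K
    rw [← this, Nat.le_zero.1 h, zero_add] at hodd
    exact (Nat.not_odd_iff_even.2 (even_two_mul _)) hodd
  obtain ⟨w₀⟩ : Nonempty {w : InfinitePlace K // IsReal w} := by
    classical rwa [← Fintype.card_pos_iff]
  have hB : minkowskiBound K ↑1 < convexBodyLTFactor K *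
      (Real.toNNReal (2 ^ Module.finrank ℚ K * √|discr K| + 1) : ENNReal) := by
    have h1 := minkowskiBound_mk0_le (K := K) ⊤ top_ne_bot
    have h0 : FractionalIdeal.mk0 K ⟨⊤, mem_nonZeroDivisors_of_ne_zero (top_ne_bot (α := Ideal (𝓞 K)))⟩ = 1 :=
      (congr_arg _ (Subtype.ext one_eq_top.symm)).trans (map_one (FractionalIdeal.mk0 K))
    rw [h0, absNorm_top, Nat.cast_one, mul_one] at h1
    refine (h1.trans_lt ?_).trans_le (le_mul_of_one_le_left (by positivity) ?_)
    · exact (ENNReal.ofReal_lt_ofReal_iff (by positivity)).2 (lt_add_one _)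
    · exact_mod_cast one_le_convexBodyLTFactor K
  obtain ⟨x, hx, hlt⟩ := exists_primitive_element_lt_of_isReal K w₀.2 hB
  refine ⟨x, hx, fun w ↦ (hlt w).le.trans ?_⟩
  rw [NNReal.coe_max, Real.coe_toNNReal _ (by positivity), NNReal.coe_one]
  refine max_le le_rfl ?_
  have : 0 ≤ (2 : ℝ) ^ Module.finrank ℚ K * √|discr K| := by positivity
  linarith

theorem prod_infinitePlace_pow_mult_eq_absNorm (x : 𝓞 K) :
    ∏ w : InfinitePlace K, w (x : K) ^ w.mult = absNorm (span {x}) := by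
  rw [prod_eq_abs_norm, absNorm_span_singleton, Nat.cast_natAbs, ← Algebra.coe_norm_int]
  simp

theorem exists_span_eq_mul_of_prod_pow_mult_eq {B : ℝ} (hB1 : 1 ≤ B)
    (hB : 2 ^ Module.finrank ℚ K * √|discr K| < B ^ Module.finrank ℚ K)
    (J : Ideal (𝓞 K)) (hJ : J ≠ ⊥) (f : InfinitePlace K → ℝ) (hf : ∀ w, 0 < f w)
    (h : ∏ w, f w ^ w.mult = B ^ Module.finrank ℚ K * absNorm J) :
    ∃ (x : 𝓞 K) (A : Ideal (𝓞 K)), x ≠ 0 ∧ A ≠ ⊥ ∧ span {x} = A * J ∧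
      (absNorm A : ℝ) ≤ B ^ Module.finrank ℚ K ∧
      ∀ w : InfinitePlace K, w x < f w ∧ f w ≤ B ^ Module.finrank ℚ K * w x := by
  classical
  have hJ0 : (0 : ℝ) < absNorm J :=
    Nat.cast_pos.2 (Nat.pos_of_ne_zero (absNorm_eq_zero_iff.not.2 hJ))
  obtain ⟨x, hxJ, hx0, hlt⟩ := exists_mem_ideal_forall_infinitePlace_lt J hJ f hf
    (by rw [h]; gcongr)
  obtain ⟨A, hA⟩ := dvd_span_singleton.2 hxJ
  have hspan : span {x} ≠ ⊥ := by simpa using hx0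
  have hA0 : A ≠ ⊥ := by
    rintro rfl
    exact hspan (by rw [hA, mul_bot])
  have hAn : (1 : ℝ) ≤ absNorm A :=
    Nat.one_le_cast.2 (Nat.pos_of_ne_zero (absNorm_eq_zero_iff.not.2 hA0))
  have hxpos : ∀ w : InfinitePlace K, 0 < w (x : K) := fun w ↦ w.pos_iff.2 (by simpa using hx0)
  have hnorm : ∏ w : InfinitePlace K, w (x : K) ^ w.mult = absNorm A * absNorm J := by
    rw [prod_infinitePlace_pow_mult_eq_absNorm, hA, map_mul, mul_comm, Nat.cast_mul]
  refine ⟨x, A, hx0, hA0, by rw [hA, mul_comm], ?_, fun w ↦ ⟨hlt w, ?_⟩⟩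
  · have : ∏ w : InfinitePlace K, w (x : K) ^ w.mult ≤ ∏ w, f w ^ w.mult :=
      Finset.prod_le_prod (fun w _ ↦ (pow_pos (hxpos w) _).le) fun w _ ↦
        pow_le_pow_left₀ (hxpos w).le (hlt w).le _
    rw [hnorm, h] at this
    exact le_of_mul_le_mul_right this hJ0
  · have h1 : f w ^ w.mult ≤ B ^ Module.finrank ℚ K * w (x : K) ^ w.mult := by
      set P := ∏ v ∈ Finset.univ.erase w, f v ^ v.mult with hP
      have hPpos : 0 < P := Finset.prod_pos fun v _ ↦ pow_pos (hf v) _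
      have e1 : f w ^ w.mult * P = B ^ Module.finrank ℚ K * absNorm J := by
        rw [hP, Finset.mul_prod_erase _ (fun v ↦ f v ^ v.mult) (Finset.mem_univ w), h]
      have e2 : (absNorm J : ℝ) ≤ w (x : K) ^ w.mult * P := by
        calc (absNorm J : ℝ) ≤ absNorm A * absNorm J := le_mul_of_one_le_left hJ0.le hAn
          _ = w (x : K) ^ w.mult * ∏ v ∈ Finset.univ.erase w, v (x : K) ^ v.mult := by
            rw [← hnorm, Finset.mul_prod_erase _ (fun v : InfinitePlace K ↦ v (x : K) ^ v.mult)
              (Finset.mem_univ w)]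
          _ ≤ _ := by
            refine mul_le_mul_of_nonneg_left ?_ (pow_pos (hxpos w) _).le
            exact Finset.prod_le_prod (fun v _ ↦ (pow_pos (hxpos v) _).le) fun v _ ↦
              pow_le_pow_left₀ (hxpos v).le (hlt v).le _
      refine le_of_mul_le_mul_right ?_ hPpos
      rw [e1, mul_assoc]
      gcongr
    have h2 : (w (x : K) / f w) ^ w.mult ≤ w (x : K) / f w :=
      pow_le_of_le_one (div_pos (hxpos w) (hf w)).le
        ((div_le_one (hf w)).2 (hlt w).le) w.mult_ne_zero
    rw [div_pow, div_le_div_iff₀ (pow_pos (hf w) _) (hf w)] at h2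
    have h3 := mul_le_mul_of_nonneg_right h1 (hf w).le
    have h4 : B ^ Module.finrank ℚ K * (w (x : K) ^ w.mult * f w) ≤
      B ^ Module.finrank ℚ K * (w (x : K) * f w ^ w.mult) := by gcongr
    refine le_of_mul_le_mul_left ?_ (pow_pos (hf w) w.mult)
    linarith

theorem card_torsion_mul_card_le {ℓ : ℕ} (hℓ : 0 < ℓ) {B : ℝ} (hB1 : 1 ≤ B)
    (hB : 2 ^ Module.finrank ℚ K * √|discr K| < B ^ Module.finrank ℚ K)
    (S : Finset (Ideal (𝓞 K))) (hS : ∀ I ∈ S, I ≠ ⊥) {Z : ℝ} (hSZ : ∀ I ∈ S, (absNorm I : ℝ) ≤ Z)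
    (hsep : ∀ I ∈ S, ∀ J ∈ S, I ≠ J → ∀ x y : 𝓞 K, x ≠ 0 → y ≠ 0 →
      span {x} * J ^ ℓ = span {y} * I ^ ℓ →
      ¬ ∀ w : InfinitePlace K, w x * absNorm J ^ ℓ ≤ Real.exp 1 ^ ℓ * Z ^ ℓ * w y ∧
        w y * absNorm I ^ ℓ ≤ Real.exp 1 ^ ℓ * Z ^ ℓ * w x)
    (T : Finset (Ideal (𝓞 K)))
    (hT : ∀ I, I ≠ ⊥ → (absNorm I : ℝ) ≤ B ^ Module.finrank ℚ K → I ∈ T) :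
    Nat.card {c : ClassGroup (𝓞 K) // c ^ ℓ = 1} * S.card ≤ T.card *
      (⌊Real.log (B ^ Module.finrank ℚ K)⌋₊ + 1) ^ Module.finrank ℚ K := by
  classical
  set d := Module.finrank ℚ K with hd
  have hd0 : 0 < d := Module.finrank_pos
  have hB0 : 0 < B := one_pos.trans_le hB1
  set M := ⌊Real.log (B ^ d)⌋₊
  have hrep : ∀ c : {c : ClassGroup (𝓞 K) // c ^ ℓ = 1}, ∃ (I : (Ideal (𝓞 K))⁰) (g : 𝓞 K),
      ClassGroup.mk0 I = c ∧ (I : Ideal (𝓞 K)) ^ ℓ = span {g} := by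
    rintro ⟨c, hc⟩
    obtain ⟨I, rfl⟩ := ClassGroup.mk0_surjective c
    rw [← map_pow, ClassGroup.mk0_eq_one_iff] at hc
    obtain ⟨g, hg⟩ := hc
    exact ⟨I, g, rfl, by simpa using hg⟩
  choose rep gen hrep hgen using hrep
  have hrep0 : ∀ c, (rep c : Ideal (𝓞 K)) ≠ ⊥ := fun c ↦ nonZeroDivisors.ne_zero (rep c).2
  have hgen0 : ∀ c, gen c ≠ 0 := by
    intro c h
    have := hgen c
    rw [h, span_singleton_eq_bot.2 rfl] at this
    exact pow_ne_zero _ (hrep0 c) this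
  have hgpos : ∀ c (w : InfinitePlace K), 0 < w (gen c : K) := fun c w ↦
    w.pos_iff.2 (by simpa using hgen0 c)
  have hSpos : ∀ I ∈ S, (1 : ℝ) ≤ absNorm I := fun I hI ↦
    Nat.one_le_cast.2 (Nat.pos_of_ne_zero (absNorm_eq_zero_iff.not.2 (hS I hI)))
  let f : {c : ClassGroup (𝓞 K) // c ^ ℓ = 1} → Ideal (𝓞 K) → InfinitePlace K → ℝ :=
    fun c I w ↦ B * w (gen c : K) ^ (ℓ : ℝ)⁻¹ * (absNorm I : ℝ) ^ (d : ℝ)⁻¹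
  have hfpos : ∀ c, ∀ I ∈ S, ∀ w, 0 < f c I w := fun c I hI w ↦ by
    have := hgpos c w
    have := one_pos.trans_le (hSpos I hI)
    positivity
  have hfprod : ∀ c, ∀ I ∈ S, ∏ w, f c I w ^ w.mult = B ^ d * absNorm ((rep c : Ideal (𝓞 K)) * I) := by
    intro c I hI
    have hI1 := one_pos.trans_le (hSpos I hI)
    simp_rw [f, mul_pow, Finset.prod_mul_distrib, Finset.prod_pow_eq_pow_sum, sum_mult_eq]
    have h1 : ∏ w : InfinitePlace K, (w (gen c : K) ^ (ℓ : ℝ)⁻¹) ^ w.mult =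
        absNorm (rep c : Ideal (𝓞 K)) := by
      calc _ = ∏ w : InfinitePlace K, (w (gen c : K) ^ w.mult) ^ (ℓ : ℝ)⁻¹ :=
            Finset.prod_congr rfl fun w _ ↦ Real.rpow_pow_comm (hgpos c w).le _ _
        _ = ((absNorm (rep c : Ideal (𝓞 K)) : ℝ) ^ ℓ) ^ (ℓ : ℝ)⁻¹ := by
          rw [Real.finsetProd_rpow _ _ fun w _ ↦ (pow_pos (hgpos c w) _).le,
            prod_infinitePlace_pow_mult_eq_absNorm, ← hgen, map_pow, Nat.cast_pow]
        _ = _ := Real.pow_rpow_inv_natCast (Nat.cast_nonneg _) hℓ.ne'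
    rw [h1, ← hd, Real.rpow_inv_natCast_pow hI1.le hd0.ne', map_mul, Nat.cast_mul, mul_assoc]
  have hex : ∀ (c : {c : ClassGroup (𝓞 K) // c ^ ℓ = 1}) (I : S),
      ∃ (x : 𝓞 K) (A : Ideal (𝓞 K)), x ≠ 0 ∧ A ≠ ⊥ ∧ span {x} = A * ((rep c : Ideal (𝓞 K)) * I) ∧
      (absNorm A : ℝ) ≤ B ^ d ∧
      ∀ w : InfinitePlace K, w x < f c I w ∧ f c I w ≤ B ^ d * w x := fun c I ↦
    exists_span_eq_mul_of_prod_pow_mult_eq hB1 hB _ (mul_ne_zero (hrep0 c) (hS I I.2)) _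
      (hfpos c I I.2) (hfprod c I I.2)
  choose x A hx0 hA0 hspan hAle hbd using hex
  have hxpos : ∀ c I (w : InfinitePlace K), 0 < w (x c I : K) := fun c I w ↦
    w.pos_iff.2 (by simpa using hx0 c I)
  let cell : {c : ClassGroup (𝓞 K) // c ^ ℓ = 1} → S → InfinitePlace K → ℕ :=
    fun c I w ↦ ⌊Real.log (f c I w / w (x c I : K))⌋₊
  have hcell : ∀ c I w, cell c I w < M + 1 := fun c I w ↦ by
    refine Nat.lt_succ_of_le (Nat.floor_le_floor (Real.log_le_log ?_ ?_))
    · exact div_pos (hfpos c I I.2 w) (hxpos c I w)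
    · exact (div_le_iff₀ (hxpos c I w)).2 (hbd c I w).2
  have hcmp : ∀ c I c' I' w, cell c I w = cell c' I' w →
      w (x c I : K) ^ ℓ * w (gen c' : K) * absNorm (I' : Ideal (𝓞 K)) ^ ℓ ≤
        Real.exp 1 ^ ℓ * Z ^ ℓ * (w (x c' I' : K) ^ ℓ * w (gen c : K)) := by
    intro c I c' I' w h
    have hI := hSpos I I.2
    have hI' := hSpos I' I'.2
    have hx := hxpos c I w
    have hx' := hxpos c' I' w
    have hf := hfpos c I I.2 w
    have hf' := hfpos c' I' I'.2 w
    have hg := hgpos c w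
    have hg' := hgpos c' w
    have h1 : Real.log (f c' I' w / w (x c' I' : K)) ≤ 1 + Real.log (f c I w / w (x c I : K)) := by
      have h2 := Nat.lt_floor_add_one (Real.log (f c' I' w / w (x c' I' : K)))
      have h3 : (cell c I w : ℝ) ≤ Real.log (f c I w / w (x c I : K)) :=
        Nat.floor_le (Real.log_nonneg ((one_le_div hx).2 (hbd c I w).1.le))
      rw [h] at h3
      change _ < (cell c' I' w : ℝ) + 1 at h2
      linarith
    have h2 : f c' I' w / w (x c' I' : K) ≤ Real.exp 1 * (f c I w / w (x c I : K)) := by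
      rw [← Real.exp_log (div_pos hf' hx'), ← Real.exp_log (div_pos hf hx), ← Real.exp_add]
      exact Real.exp_le_exp.2 h1
    rw [← mul_div_assoc, div_le_div_iff₀ hx' hx] at h2
    have h3 := pow_le_pow_left₀ (by positivity) h2 ℓ
    simp only [f, mul_pow, Real.rpow_inv_natCast_pow hg.le hℓ.ne',
      Real.rpow_inv_natCast_pow hg'.le hℓ.ne'] at h3
    have hZ : 0 ≤ Z := by linarith [hSZ I I.2]
    set n := (absNorm (I : Ideal (𝓞 K)) : ℝ) ^ (d : ℝ)⁻¹
    set n' := (absNorm (I' : Ideal (𝓞 K)) : ℝ) ^ (d : ℝ)⁻¹ with hn'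
    have hn0 : 0 ≤ n := by positivity
    have hn'0 : 0 < n' := by positivity
    have h4 : n * absNorm (I' : Ideal (𝓞 K)) ≤ Z * n' := by
      have e1 : (absNorm (I' : Ideal (𝓞 K)) : ℝ) = n' ^ (d - 1) * n' := by
        rw [pow_sub_one_mul hd0.ne', hn', Real.rpow_inv_natCast_pow (by positivity) hd0.ne']
      have e2 : n * n' ^ (d - 1) ≤ Z := by
        calc n * n' ^ (d - 1) ≤ Z ^ (d : ℝ)⁻¹ * (Z ^ (d : ℝ)⁻¹) ^ (d - 1) := by
              gcongr
              · exact Real.rpow_le_rpow (by positivity) (hSZ I I.2) (by positivity)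
              · exact Real.rpow_le_rpow (by positivity) (hSZ I' I'.2) (by positivity)
          _ = Z := by rw [mul_pow_sub_one hd0.ne', Real.rpow_inv_natCast_pow hZ hd0.ne']
      rw [e1, ← mul_assoc]
      gcongr
    have h5 := pow_le_pow_left₀ (by positivity) h4 ℓ
    rw [mul_pow, mul_pow] at h5
    refine le_of_mul_le_mul_left ?_ (mul_pos (pow_pos hB0 ℓ) (pow_pos hn'0 ℓ))
    calc B ^ ℓ * n' ^ ℓ * (w (x c I : K) ^ ℓ * w (gen c' : K) * absNorm (I' : Ideal (𝓞 K)) ^ ℓ)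
        = (B ^ ℓ * w (gen c' : K) * n' ^ ℓ * w (x c I : K) ^ ℓ) *
          absNorm (I' : Ideal (𝓞 K)) ^ ℓ := by ring
      _ ≤ (Real.exp 1 ^ ℓ * (B ^ ℓ * w (gen c : K) * n ^ ℓ * w (x c' I' : K) ^ ℓ)) *
          absNorm (I' : Ideal (𝓞 K)) ^ ℓ :=
        mul_le_mul_of_nonneg_right (by linarith) (by positivity)
      _ = Real.exp 1 ^ ℓ * B ^ ℓ * w (gen c : K) * w (x c' I' : K) ^ ℓ *
          (n ^ ℓ * absNorm (I' : Ideal (𝓞 K)) ^ ℓ) := by ring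
      _ ≤ Real.exp 1 ^ ℓ * B ^ ℓ * w (gen c : K) * w (x c' I' : K) ^ ℓ * (Z ^ ℓ * n' ^ ℓ) := by
        gcongr
      _ = _ := by ring
  have hinj : Function.Injective fun p : {c : ClassGroup (𝓞 K) // c ^ ℓ = 1} × S ↦
      ((⟨A p.1 p.2, hT _ (hA0 _ _) (hAle _ _)⟩, fun w ↦ ⟨cell p.1 p.2 w, hcell _ _ _⟩) :
        T × (InfinitePlace K → Fin (M + 1))) := by
    rintro ⟨c, I⟩ ⟨c', I'⟩ h
    simp only [Prod.mk.injEq, Subtype.mk.injEq, funext_iff, Fin.mk.injEq] at h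
    obtain ⟨hA, hc⟩ := h
    by_cases hI : I = I'
    · subst hI
      suffices ClassGroup.mk0 (rep c) = ClassGroup.mk0 (rep c') by
        rw [hrep, hrep] at this
        rw [Subtype.ext this]
      rw [ClassGroup.mk0_eq_mk0_iff]
      refine ⟨x c' I, x c I, hx0 _ _, hx0 _ _, ?_⟩
      rw [hspan, hspan, hA]
      ring
    · exfalso
      refine hsep I I.2 I' I'.2 (fun h ↦ hI (Subtype.ext h)) (x c I ^ ℓ * gen c')
        (x c' I' ^ ℓ * gen c) (mul_ne_zero (pow_ne_zero _ (hx0 _ _)) (hgen0 _))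
        (mul_ne_zero (pow_ne_zero _ (hx0 _ _)) (hgen0 _)) ?_ fun w ↦ ⟨?_, ?_⟩
      · rw [← span_singleton_mul_span_singleton, ← span_singleton_mul_span_singleton,
          ← span_singleton_pow, ← span_singleton_pow, hspan, hspan, ← hgen, ← hgen, hA]
        ring
      · simpa using hcmp c I c' I' w (hc w)
      · simpa using hcmp c' I' c I w (hc w).symm
  have hcard := Nat.card_le_card_of_injective _ hinj
  rw [Nat.card_prod, Nat.card_prod, Nat.card_eq_fintype_card (α := S), Fintype.card_coe,
    Nat.card_eq_fintype_card (α := T), Fintype.card_coe, Nat.card_pi] at hcard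
  refine hcard.trans ?_
  simp only [Nat.card_eq_fintype_card, Fintype.card_fin, Finset.prod_const, Finset.card_univ]
  gcongr
  · omega
  · have := card_add_two_mul_card_eq_rank K
    rw [card_eq_nrRealPlaces_add_nrComplexPlaces]
    omega

end Minkowski

section PureField

variable {K : Type*} [Field K] [NumberField K] {d a : ℕ} {θ : K}

theorem natDegree_minpoly_of_adjoin_eq_top (htop : IntermediateField.adjoin ℚ {θ} = ⊤)
    (hfin : Module.finrank ℚ K = d) : (minpoly ℚ θ).natDegree = d :=
  ((Field.primitive_element_iff_minpoly_natDegree_eq ℚ θ).1 htop).trans hfin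

theorem eq_zero_of_aeval_eq_zero_of_natDegree_lt (htop : IntermediateField.adjoin ℚ {θ} = ⊤)
    (hfin : Module.finrank ℚ K = d) {P : ℚ[X]} (hP : aeval θ P = 0) (hdeg : P.natDegree < d) :
    P = 0 := by
  by_contra h
  have := natDegree_le_of_dvd (minpoly.dvd ℚ θ hP) h
  rw [natDegree_minpoly_of_adjoin_eq_top htop hfin] at this
  omega

theorem exists_basis_pow (htop : IntermediateField.adjoin ℚ {θ} = ⊤)
    (hfin : Module.finrank ℚ K = d) :
    ∃ b : Module.Basis (Fin d) ℚ K, ∀ i, b i = θ ^ (i : ℕ) := by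
  have hd : 0 < d := hfin ▸ Module.finrank_pos
  have : Nonempty (Fin d) := ⟨⟨0, hd⟩⟩
  have hdeg := natDegree_minpoly_of_adjoin_eq_top htop hfin
  have hli : LinearIndependent ℚ fun i : Fin d ↦ θ ^ (i : ℕ) := by
    have := linearIndependent_pow (K := ℚ) θ
    rwa [hdeg] at this
  exact ⟨basisOfLinearIndependentOfCardEqFinrank hli (by simp [hfin]), fun i ↦ by simp⟩

theorem exists_natDegree_lt_aeval_eq (htop : IntermediateField.adjoin ℚ {θ} = ⊤)
    (hfin : Module.finrank ℚ K = d) (x : K) : ∃ P : ℚ[X], P.natDegree < d ∧ aeval θ P = x := by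
  have hd : 0 < d := hfin ▸ Module.finrank_pos
  obtain ⟨b, hb⟩ := exists_basis_pow htop hfin
  refine ⟨∑ i : Fin d, C (b.repr x i) * X ^ (i : ℕ), ?_, ?_⟩
  · rw [Nat.lt_iff_le_pred hd]
    exact natDegree_sum_le_of_forall_le _ _ fun i _ ↦ (natDegree_C_mul_X_pow_le _ _).trans
      (by omega)
  · rw [map_sum]
    conv_rhs => rw [← b.sum_repr x]
    exact Finset.sum_congr rfl fun i _ ↦ by simp [hb, Algebra.smul_def]

theorem trace_pow_eq_zero (hθ : θ ^ d = a) (htop : IntermediateField.adjoin ℚ {θ} = ⊤)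
    (hfin : Module.finrank ℚ K = d) {k : ℕ} (hk : ¬ d ∣ k) : Algebra.trace ℚ K (θ ^ k) = 0 := by
  classical
  have hd : 0 < d := hfin ▸ Module.finrank_pos
  obtain ⟨b, hb⟩ := exists_basis_pow htop hfin
  rw [Algebra.trace_eq_matrix_trace b, Matrix.trace]
  refine Finset.sum_eq_zero fun i _ ↦ ?_
  rw [Matrix.diag_apply, Algebra.leftMulMatrix_eq_repr_mul, hb, ← pow_add]
  have h : θ ^ (k + i) = ((a : ℚ) ^ ((k + i) / d)) • b ⟨(k + i) % d, Nat.mod_lt _ hd⟩ := by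
    conv_lhs => rw [← Nat.div_add_mod (k + i) d, pow_add, pow_mul, hθ]
    rw [hb, Algebra.smul_def]
    simp
  rw [h, map_smul, b.repr_self, Finsupp.smul_apply, Finsupp.single_apply, if_neg, smul_zero]
  intro h
  have h1 := congr_arg Fin.val h
  simp only at h1
  refine hk ((Nat.dvd_iff_mod_eq_zero).2 ?_)
  have h2 : (k + i) ≡ 0 + i [MOD d] := by
    rw [Nat.ModEq, h1, zero_add, Nat.mod_eq_of_lt i.2]
  exact Nat.ModEq.add_right_cancel' _ h2

theorem trace_aeval_mul_inv_pow (hθ : θ ^ d = a) (ha : a ≠ 0)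
    (htop : IntermediateField.adjoin ℚ {θ} = ⊤)
    (hfin : Module.finrank ℚ K = d) {P : ℚ[X]} (hP : P.natDegree < d) {m : ℕ} (hm : m < d) :
    Algebra.trace ℚ K (aeval θ P * (θ ^ m)⁻¹) = d * P.coeff m := by
  have hθ0 : θ ≠ 0 := by
    rintro rfl
    rw [zero_pow (by omega)] at hθ
    exact ha (by exact_mod_cast hθ.symm)
  have ha' : (a : ℚ) ≠ 0 := Nat.cast_ne_zero.2 ha
  have h1 : (θ ^ m)⁻¹ = ((a : ℚ)⁻¹) • θ ^ (d - m) := by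
    refine inv_eq_of_mul_eq_one_right ?_
    rw [mul_smul_comm, ← pow_add, Nat.add_sub_cancel' hm.le, hθ, Algebra.smul_def]
    simp [ha]
  rw [aeval_eq_sum_range' hP, Finset.sum_mul, map_sum,
    Finset.sum_eq_single_of_mem m (Finset.mem_range.2 hm)]
  · rw [smul_mul_assoc, mul_inv_cancel₀ (pow_ne_zero _ hθ0), map_smul,
      ← map_one (algebraMap ℚ K), Algebra.trace_algebraMap, hfin]
    simp [mul_comm]
  · intro i hi him
    rw [h1, smul_mul_smul_comm, ← pow_add, map_smul, trace_pow_eq_zero hθ htop hfin, smul_zero]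
    have := Finset.mem_range.1 hi
    rintro ⟨c, hc⟩
    have h2 : 0 < c := Nat.pos_of_ne_zero (by rintro rfl; omega)
    have h3 : c < 2 := by
      by_contra! h
      have := Nat.mul_le_mul_left d h
      omega
    obtain rfl : c = 1 := by omega
    omega

/-- A Lagrange resolvent of an algebraic integer `x`: it isolates the coefficient of `θ ^ m`. -/
theorem exists_isIntegral_norm_eq (hθ : θ ^ d = a) (ha : a ≠ 0)
    (htop : IntermediateField.adjoin ℚ {θ} = ⊤)
    (hfin : Module.finrank ℚ K = d) {P : ℚ[X]} (hP : P.natDegree < d) {m : ℕ} (hm : m < d)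
    {x : 𝓞 K} (hx : aeval θ P = (x : K)) {B : ℝ} (hB : ∀ w : InfinitePlace K, w x ≤ B) :
    ∃ z : ℂ, IsIntegral ℤ z ∧ ‖z‖ ≤ d * B ∧ z ^ d = ((d * P.coeff m) ^ d * (a : ℚ) ^ m : ℚ) := by
  have hθ0 : θ ≠ 0 := by
    rintro rfl
    rw [zero_pow (by omega)] at hθ
    exact ha (by exact_mod_cast hθ.symm)
  obtain τ : K →ₐ[ℚ] ℂ := IsAlgClosed.lift
  have hd : d ≠ 0 := by omega
  have hroot : ∀ σ : K →ₐ[ℚ] ℂ, (τ θ * (σ θ)⁻¹) ^ d = 1 := fun σ ↦ by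
    rw [mul_pow, inv_pow, ← map_pow, ← map_pow, hθ, map_natCast, map_natCast,
      mul_inv_cancel₀ (Nat.cast_ne_zero.2 ha)]
  refine ⟨∑ σ : K →ₐ[ℚ] ℂ, σ (x : K) * (τ θ * (σ θ)⁻¹) ^ m, ?_, ?_, ?_⟩
  · refine IsIntegral.sum _ fun σ _ ↦ ?_
    refine IsIntegral.mul (x.isIntegral_coe.map (σ.restrictScalars ℤ)) (IsIntegral.pow ?_ _)
    exact IsIntegral.of_pow (Nat.pos_of_ne_zero hd) (by rw [hroot]; exact isIntegral_one)
  · refine (norm_sum_le _ _).trans ?_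
    calc _ ≤ ∑ σ : K →ₐ[ℚ] ℂ, B := Finset.sum_le_sum fun σ _ ↦ by
          rw [norm_mul, norm_pow, Complex.norm_eq_one_of_pow_eq_one (hroot σ) hd, one_pow, mul_one]
          exact hB (InfinitePlace.mk σ.toRingHom)
      _ = _ := by
        rw [Finset.sum_const, nsmul_eq_mul, Finset.card_univ, AlgHom.card, hfin]
  · have : ∑ σ : K →ₐ[ℚ] ℂ, σ (x : K) * (τ θ * (σ θ)⁻¹) ^ m =
        τ θ ^ m * (algebraMap ℚ ℂ (d * P.coeff m)) := by
      rw [← trace_aeval_mul_inv_pow hθ ha htop hfin hP hm, trace_eq_sum_embeddings ℂ,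
        Finset.mul_sum]
      refine Finset.sum_congr rfl fun σ _ ↦ ?_
      rw [hx, map_mul, map_inv₀, map_pow, mul_pow, inv_pow]
      ring
    rw [this, mul_pow, ← pow_mul, mul_comm m, pow_mul, ← map_pow, hθ]
    simp
    ring


theorem exists_int_cast_eq_of_pow_mul {d s : ℕ} (hs : ∀ p : ℕ, p.Prime → ¬ p ^ d ∣ s)
    {u : ℚ} {k : ℤ} (h : u ^ d * s = k) : ∃ n : ℤ, (n : ℚ) = u := by
  have hden : (u.den : ℚ) ^ d ≠ 0 := pow_ne_zero _ (Nat.cast_ne_zero.2 u.den_ne_zero)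
  have h1 : u.num ^ d * s = k * (u.den : ℤ) ^ d := by
    have h2 : (u.num : ℚ) ^ d * s = k * (u.den : ℚ) ^ d := by
      rw [← h]
      nth_rewrite 2 [← Rat.num_div_den u]
      rw [div_pow]
      field_simp
    exact_mod_cast h2
  have h2 : u.den ^ d ∣ s := by
    have h3 : ((u.den ^ d : ℕ) : ℤ) ∣ u.num ^ d * s := ⟨k, by rw [h1]; push_cast; ring⟩
    have h4 : IsCoprime ((u.den ^ d : ℕ) : ℤ) (u.num ^ d) := by
      push_cast
      refine IsCoprime.pow (Int.isCoprime_iff_gcd_eq_one.2 ?_)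
      rw [Int.gcd_comm]
      exact u.reduced
    exact Int.natCast_dvd_natCast.1 (h4.dvd_of_dvd_mul_left h3)
  have h5 : u.den = 1 := by
    by_contra hne
    obtain ⟨p, hp, hpd⟩ := Nat.exists_prime_and_dvd hne
    exact hs p hp ((pow_dvd_pow_of_dvd hpd d).trans h2)
  exact ⟨u.num, (Rat.den_eq_one_iff u).1 h5⟩

theorem not_prime_pow_dvd_prod_pow {ι : Type*} {t : Finset ι} {A : ι → ℕ} {e : ι → ℕ} {d : ℕ}
    (hsq : ∀ i ∈ t, Squarefree (A i))
    (hcop : ∀ i ∈ t, ∀ j ∈ t, i ≠ j → (A i).Coprime (A j)) (hd : d ≠ 0)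
    (he : ∀ i ∈ t, e i < d) {p : ℕ} (hp : p.Prime) : ¬ p ^ d ∣ ∏ i ∈ t, A i ^ e i := by
  classical
  intro h
  obtain ⟨i, hi, hpi⟩ := (hp.prime.dvd_finsetProd_iff _).1 ((dvd_pow_self p hd).trans h)
  have hpA : p ∣ A i := hp.dvd_of_dvd_pow hpi
  rw [← Finset.mul_prod_erase t _ hi] at h
  have hcop' : (p ^ d).Coprime (∏ j ∈ t.erase i, A j ^ e j) := by
    refine Nat.Coprime.prod_right fun j hj ↦ Nat.Coprime.pow _ _ ?_
    exact Nat.Coprime.coprime_dvd_left hpA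
      (hcop i hi j (Finset.mem_of_mem_erase hj) (Finset.ne_of_mem_erase hj).symm)
  replace h := hcop'.dvd_of_dvd_mul_right h
  obtain ⟨b, hb⟩ := hpA
  have hpb : ¬ p ∣ b := by
    rintro ⟨c, rfl⟩
    have := hsq i hi p ⟨c, by rw [hb]; ring⟩
    exact hp.ne_one (Nat.isUnit_iff.1 this)
  rw [hb, mul_pow] at h
  have := (((hp.coprime_iff_not_dvd.2 hpb).pow d (e i))).dvd_of_dvd_mul_right h
  exact (he i hi).not_ge ((Nat.pow_dvd_pow_iff_le_right hp.one_lt).1 this)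

/-- `θ` is a `d`-th root of `a = ∏ A i ^ i` generating the pure field `K` of degree `d`. -/
structure IsPureFieldGenerator (d a : ℕ) (A : ℕ → ℕ) (θ : K) : Prop where
  squarefree : ∀ i ∈ Finset.Icc 1 (d - 1), Squarefree (A i) ∧ 0 < A i
  coprime : ∀ i ∈ Finset.Icc 1 (d - 1), ∀ j ∈ Finset.Icc 1 (d - 1), i ≠ j →
    Nat.Coprime (A i) (A j)
  eq_prod : a = ∏ i ∈ Finset.Icc 1 (d - 1), A i ^ i
  pow_eq : θ ^ d = a
  adjoin_eq_top : IntermediateField.adjoin ℚ {θ} = ⊤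
  finrank_eq : Module.finrank ℚ K = d

theorem IsPureFieldGenerator.ne_zero {A : ℕ → ℕ} (h : IsPureFieldGenerator d a A θ) : a ≠ 0 := by
  rw [h.eq_prod, Finset.prod_ne_zero_iff]
  exact fun i hi ↦ pow_ne_zero _ (h.squarefree i hi).2.ne'

theorem exists_int_eq_coeff_mul {A : ℕ → ℕ} (h : IsPureFieldGenerator d a A θ)
    {P : ℚ[X]} (hP : P.natDegree < d) {m : ℕ} (hm : m < d)
    {x : 𝓞 K} (hx : aeval θ P = (x : K)) {B : ℝ} (hB : ∀ w : InfinitePlace K, w x ≤ B) :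
    ∃ n : ℤ, (n : ℚ) = d * P.coeff m * ∏ i ∈ Finset.Icc 1 (d - 1), (A i : ℚ) ^ (i * m / d) ∧
      |(n : ℝ)| ^ d * ∏ i ∈ Finset.Icc 1 (d - 1), (A i : ℝ) ^ (i * m % d) ≤ (d * B) ^ d := by
  have hd : d ≠ 0 := by omega
  obtain ⟨z, hz, hzB, hzd⟩ := exists_isIntegral_norm_eq h.pow_eq h.ne_zero h.adjoin_eq_top
    h.finrank_eq hP hm hx hB
  set u : ℚ := d * P.coeff m * ∏ i ∈ Finset.Icc 1 (d - 1), (A i : ℚ) ^ (i * m / d) with hu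
  set s : ℕ := ∏ i ∈ Finset.Icc 1 (d - 1), A i ^ (i * m % d) with hs
  have hsplit : ((d * P.coeff m) ^ d * (a : ℚ) ^ m : ℚ) = u ^ d * s := by
    rw [hu, hs, h.eq_prod, mul_pow (_ * _), mul_assoc]
    congr 1
    push_cast
    rw [← Finset.prod_pow, ← Finset.prod_pow, ← Finset.prod_mul_distrib]
    refine Finset.prod_congr rfl fun i _ ↦ ?_
    rw [← pow_mul, ← pow_mul, ← pow_add]
    congr 1
    rw [mul_comm (i * m / d), Nat.div_add_mod]
  rw [hsplit] at hzd
  have hint : IsIntegral ℤ (u ^ d * s : ℚ) := by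
    have h1 := hz.pow d
    rw [hzd] at h1
    exact (isIntegral_algebraMap_iff (A := ℚ) (B := ℂ) (algebraMap ℚ ℂ).injective).1 h1
  obtain ⟨k, hk⟩ := IsIntegrallyClosed.isIntegral_iff.1 hint
  obtain ⟨n, hn⟩ := exists_int_cast_eq_of_pow_mul
    (fun p hp ↦ not_prime_pow_dvd_prod_pow (fun i hi ↦ (h.squarefree i hi).1) h.coprime hd
      (fun i _ ↦ Nat.mod_lt _ (Nat.pos_of_ne_zero hd)) hp) hk.symm
  refine ⟨n, hn, ?_⟩
  rw [← hn] at hzd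
  have h2 : ‖z‖ ^ d = |(n : ℝ)| ^ d * s := by
    rw [← norm_pow, hzd]
    simp
  have h3 : (s : ℝ) = ∏ i ∈ Finset.Icc 1 (d - 1), (A i : ℝ) ^ (i * m % d) := by
    rw [hs]
    push_cast
    rfl
  rw [← h3, ← h2]
  exact pow_le_pow_left₀ (norm_nonneg _) hzB d

/-- The product of the `A i`, each raised to the fractional part of `i * m / d`. -/
noncomputable def fractProd (A : ℕ → ℕ) (d m : ℕ) : ℝ :=
  ∏ i ∈ Finset.Icc 1 (d - 1), (A i : ℝ) ^ (((i * m : ℕ) : ℝ) / (d : ℝ) - ((i * m / d : ℕ) : ℝ))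

theorem fract_eq_mod_div {d : ℕ} (hd : d ≠ 0) (k : ℕ) :
    (k : ℝ) / (d : ℝ) - ((k / d : ℕ) : ℝ) = ((k % d : ℕ) : ℝ) / d := by
  have h1 : (k : ℝ) = d * ((k / d : ℕ) : ℝ) + ((k % d : ℕ) : ℝ) := by
    exact_mod_cast (Nat.div_add_mod k d).symm
  have : (d : ℝ) ≠ 0 := Nat.cast_ne_zero.2 hd
  nth_rewrite 1 [h1]
  field_simp
  ring

theorem fractProd_pow {d : ℕ} (hd : d ≠ 0) (A : ℕ → ℕ) (m : ℕ) :
    fractProd A d m ^ d = ∏ i ∈ Finset.Icc 1 (d - 1), (A i : ℝ) ^ (i * m % d) := by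
  rw [fractProd, ← Finset.prod_pow]
  refine Finset.prod_congr rfl fun i hi ↦ ?_
  rw [fract_eq_mod_div hd, ← Real.rpow_natCast, ← Real.rpow_mul (Nat.cast_nonneg _),
    div_mul_cancel₀ _ (Nat.cast_ne_zero.2 hd), Real.rpow_natCast]

theorem IsPureFieldGenerator.one_le_fractProd {A : ℕ → ℕ} (h : IsPureFieldGenerator d a A θ)
    (m : ℕ) : 1 ≤ fractProd A d m := by
  have hd : d ≠ 0 := h.finrank_eq ▸ Module.finrank_pos.ne'
  have hle : ∏ i ∈ Finset.Icc 1 (d - 1), (1 : ℝ) ≤ fractProd A d m := by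
    refine Finset.prod_le_prod (fun _ _ ↦ zero_le_one) fun i hi ↦ ?_
    rw [fract_eq_mod_div hd]
    exact Real.one_le_rpow (Nat.one_le_cast.2 (h.squarefree i hi).2) (by positivity)
  simpa using hle

theorem IsPureFieldGenerator.fractProd_le {A : ℕ → ℕ} (h : IsPureFieldGenerator d a A θ)
    (m : ℕ) : fractProd A d m ≤ a := by
  have hd : d ≠ 0 := h.finrank_eq ▸ Module.finrank_pos.ne'
  rw [h.eq_prod, fractProd, Nat.cast_prod]
  refine Finset.prod_le_prod (fun i _ ↦ by positivity) fun i hi ↦ ?_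
  have h1 : (1 : ℝ) ≤ A i := Nat.one_le_cast.2 (h.squarefree i hi).2
  rw [fract_eq_mod_div hd, Nat.cast_pow, ← Real.rpow_natCast]
  refine Real.rpow_le_rpow_of_exponent_le h1 ((div_le_one (by positivity)).2 ?_ |>.trans
    (Nat.one_le_cast.2 (Finset.mem_Icc.1 hi).1))
  exact_mod_cast (Nat.mod_lt _ (Nat.pos_of_ne_zero hd)).le

theorem fractProd_le_of_coeff_ne_zero {A : ℕ → ℕ} (h : IsPureFieldGenerator d a A θ)
    {P : ℚ[X]} (hP : P.natDegree < d) {m : ℕ} (hm : m < d)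
    {x : 𝓞 K} (hx : aeval θ P = (x : K)) {B : ℝ} (hB0 : 0 ≤ B)
    (hB : ∀ w : InfinitePlace K, w x ≤ B) (hc : P.coeff m ≠ 0) : fractProd A d m ≤ d * B := by
  have hd : d ≠ 0 := by omega
  obtain ⟨n, hn, hle⟩ := exists_int_eq_coeff_mul h hP hm hx hB
  have hn0 : n ≠ 0 := by
    rintro rfl
    rw [Int.cast_zero, eq_comm] at hn
    refine mul_ne_zero (mul_ne_zero (Nat.cast_ne_zero.2 hd) hc) ?_ hn
    exact Finset.prod_ne_zero_iff.2 fun i hi ↦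
      pow_ne_zero _ (Nat.cast_ne_zero.2 (h.squarefree i hi).2.ne')
  have hn1 : (1 : ℝ) ≤ |(n : ℝ)| := by exact_mod_cast Int.one_le_abs hn0
  refine le_of_pow_le_pow_left₀ hd (by positivity) (le_trans ?_ hle)
  rw [fractProd_pow hd]
  exact le_mul_of_one_le_left (by positivity) (one_le_pow₀ hn1)

theorem exists_rat_eq_of_mul_eq {A : ℕ → ℕ} (h : IsPureFieldGenerator d a A θ) (hodd : Odd d)
    {B : ℝ} (hB0 : 0 ≤ B)
    (hB : ∀ m, (d + 1) / 2 ≤ m → m ≤ d - 1 → d * B < fractProd A d m)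
    {x y : 𝓞 K} {c : ℚ} (hc : c ≠ 0) (hxy : (x : K) * y = c)
    (hx : ∀ w : InfinitePlace K, w x ≤ B) (hy : ∀ w : InfinitePlace K, w y ≤ B) :
    ∃ q : ℚ, (x : K) = q := by
  obtain ⟨r, hr⟩ := hodd
  have hdeg : ∀ z : 𝓞 K, z ≠ 0 → (∀ w : InfinitePlace K, w z ≤ B) →
      ∃ P : ℚ[X], P ≠ 0 ∧ P.natDegree ≤ r ∧ aeval θ P = (z : K) := by
    intro z hz0 hz
    obtain ⟨P, hPd, hP⟩ := exists_natDegree_lt_aeval_eq h.adjoin_eq_top h.finrank_eq (z : K)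
    have hP0 : P ≠ 0 := by
      rintro rfl
      rw [map_zero] at hP
      exact hz0 (by simpa using hP.symm)
    refine ⟨P, hP0, ?_, hP⟩
    by_contra! hlt
    exact (hB P.natDegree (by omega) (by omega)).not_ge
      (fractProd_le_of_coeff_ne_zero h hPd hPd hP hB0 hz (leadingCoeff_ne_zero.2 hP0))
  have hxy0 : (x : K) * y ≠ 0 := by
    rw [hxy]
    exact_mod_cast hc
  obtain ⟨P, hP0, hPr, hP⟩ := hdeg x (fun h ↦ by simp [h] at hxy0) hx
  obtain ⟨Q, hQ0, hQr, hQ⟩ := hdeg y (fun h ↦ by simp [h] at hxy0) hy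
  have hPQ : P * Q - C c = 0 := by
    refine eq_zero_of_aeval_eq_zero_of_natDegree_lt h.adjoin_eq_top h.finrank_eq ?_ ?_
    · simp [hP, hQ, hxy]
    · rw [natDegree_sub_C]
      exact natDegree_mul_le.trans_lt (by omega)
  have h1 := congr_arg natDegree (sub_eq_zero.1 hPQ)
  rw [natDegree_mul hP0 hQ0, natDegree_C] at h1
  refine ⟨P.coeff 0, ?_⟩
  rw [← hP, eq_C_of_natDegree_eq_zero (by omega : P.natDegree = 0)]
  simp

theorem IsPureFieldGenerator.le_discr {A : ℕ → ℕ} (h : IsPureFieldGenerator d a A θ)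
    (hodd : Odd d) (hd1 : 1 < d) :
    (a : ℝ) ≤ (d * (2 ^ d * √|discr K| + 1) ^ (d - 1)) ^ d := by
  obtain ⟨x, htop, hx⟩ := exists_primitive_element_infinitePlace_le (K := K)
    (by rwa [h.finrank_eq])
  obtain ⟨b, hb⟩ := exists_basis_pow htop h.finrank_eq
  set B := 2 ^ d * √|discr K| + 1 with hBdef
  have hB1 : 1 ≤ B := le_add_of_nonneg_left (by positivity)
  have htr : ∀ {P : ℚ[X]}, P.natDegree < d →
      Algebra.trace ℚ K (aeval θ P * θ⁻¹) = d * P.coeff 1 := fun hP ↦ by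
    simpa using trace_aeval_mul_inv_pow h.pow_eq h.ne_zero h.adjoin_eq_top h.finrank_eq hP hd1
  obtain ⟨j, hj⟩ : ∃ j : Fin d, Algebra.trace ℚ K ((x : K) ^ (j : ℕ) * θ⁻¹) ≠ 0 := by
    by_contra! hall
    have h0 : Algebra.trace ℚ K ∘ₗ LinearMap.mulRight ℚ θ⁻¹ = 0 :=
      b.ext fun j ↦ by simpa [hb] using hall j
    have h1 := htr (P := X) (by simpa using hd1)
    have h2 := LinearMap.congr_fun h0 θ
    simp only [LinearMap.comp_apply, LinearMap.mulRight_apply, LinearMap.zero_apply] at h2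
    rw [aeval_X, h2, coeff_X_one, mul_one, eq_comm, Nat.cast_eq_zero] at h1
    omega
  obtain ⟨P, hPd, hP⟩ := exists_natDegree_lt_aeval_eq h.adjoin_eq_top h.finrank_eq
    (((x ^ (j : ℕ) : 𝓞 K)) : K)
  have hc : P.coeff 1 ≠ 0 := by
    intro h0
    have := htr hPd
    rw [hP, h0, mul_zero] at this
    exact hj (by simpa using this)
  have hle := fractProd_le_of_coeff_ne_zero h hPd hd1 hP (B := B ^ (d - 1)) (by positivity)
    (fun w ↦ by
      have := hx w
      rw [h.finrank_eq] at this
      calc w ((x ^ (j : ℕ) : 𝓞 K) : K) = w (x : K) ^ (j : ℕ) := by simp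
        _ ≤ B ^ (j : ℕ) := pow_le_pow_left₀ (apply_nonneg w _) this _
        _ ≤ B ^ (d - 1) := pow_le_pow_right₀ hB1 (by omega)) hc
  have h1 := pow_le_pow_left₀ (zero_le_one.trans (h.one_le_fractProd 1)) hle d
  rw [fractProd_pow (by omega)] at h1
  refine le_trans (le_of_eq ?_) h1
  rw [h.eq_prod]
  push_cast
  refine Finset.prod_congr rfl fun i hi ↦ ?_
  rw [mul_one, Nat.mod_eq_of_lt]
  have := Finset.mem_Icc.1 hi
  omega

end PureField

section PurePrimes

open Ideal

variable {K : Type*} [Field K] [NumberField K] {d a : ℕ} {A : ℕ → ℕ} {θ : K}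

theorem IsPureFieldGenerator.exists_ringOfIntegers_coe_eq (h : IsPureFieldGenerator d a A θ) :
    ∃ t : 𝓞 K, (t : K) = θ := by
  have hd : 0 < d := h.finrank_eq ▸ Module.finrank_pos
  refine ⟨⟨θ, IsIntegral.of_pow hd ?_⟩, rfl⟩
  simpa [h.pow_eq] using isIntegral_algebraMap (R := ℤ) (A := K) (x := (a : ℤ))

theorem exists_int_eq_coeff (h : IsPureFieldGenerator d a A θ) {P : ℚ[X]} (hP : P.natDegree < d)
    {m : ℕ} (hm : m < d) {x : 𝓞 K} (hx : aeval θ P = (x : K)) :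
    ∃ n : ℤ, (n : ℚ) = d * P.coeff m * ∏ i ∈ Finset.Icc 1 (d - 1), (A i : ℚ) ^ (i * m / d) := by
  obtain ⟨n, hn, -⟩ := exists_int_eq_coeff_mul h hP hm hx (B := ∑ w : InfinitePlace K, w (x : K))
    fun w ↦ Finset.single_le_sum (f := fun w : InfinitePlace K ↦ w (x : K))
      (fun v _ ↦ apply_nonneg v _) (Finset.mem_univ w)
  exact ⟨n, hn⟩

theorem exists_int_eq_mul_coeff_of_le_one (h : IsPureFieldGenerator d a A θ) {P : ℚ[X]}
    (hP : P.natDegree < d) {m : ℕ} (hm : m < d) (hm1 : m ≤ 1) {x : 𝓞 K}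
    (hx : aeval θ P = (x : K)) : ∃ n : ℤ, (n : ℚ) = d * P.coeff m := by
  obtain ⟨n, hn⟩ := exists_int_eq_coeff h hP hm hx
  refine ⟨n, ?_⟩
  rw [hn, Finset.prod_eq_one, mul_one]
  intro i hi
  have := Finset.mem_Icc.1 hi
  rw [Nat.div_eq_of_lt, pow_zero]
  exact (Nat.mul_le_mul_left i hm1).trans_lt (by omega)

theorem exists_int_mul_eq_aeval (h : IsPureFieldGenerator d a A θ) {t : 𝓞 K} (ht : (t : K) = θ)
    (x : 𝓞 K) : ∃ Q : ℤ[X], ((d * a : ℕ) : 𝓞 K) * x = aeval t Q := by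
  obtain ⟨P, hPd, hP⟩ := exists_natDegree_lt_aeval_eq h.adjoin_eq_top h.finrank_eq (x : K)
  have hint : ∀ m : Fin d, ∃ n : ℤ, (n : ℚ) = (d * a : ℕ) * P.coeff m := by
    intro m
    obtain ⟨n, hn⟩ := exists_int_eq_coeff h hPd m.2 hP
    obtain ⟨e, he⟩ : ∏ i ∈ Finset.Icc 1 (d - 1), A i ^ (i * m / d) ∣ a := by
      conv_rhs => rw [h.eq_prod]
      refine Finset.prod_dvd_prod_of_dvd _ _ fun i _ ↦ pow_dvd_pow _ ?_
      exact Nat.div_le_of_le_mul (by rw [mul_comm]; exact Nat.mul_le_mul_right i m.2.le)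
    refine ⟨n * e, ?_⟩
    have he' : (a : ℚ) = (∏ i ∈ Finset.Icc 1 (d - 1), (A i : ℚ) ^ (i * m / d)) * e := by
      rw [he]
      push_cast
      rfl
    push_cast
    rw [hn, he']
    ring
  choose n hn using hint
  refine ⟨∑ m : Fin d, C (n m) * X ^ (m : ℕ), ?_⟩
  apply RingOfIntegers.coe_injective
  have ht' : algebraMap (𝓞 K) K t = θ := ht
  have h1 : algebraMap (𝓞 K) K x = ∑ m : Fin d, P.coeff m • θ ^ (m : ℕ) := by
    rw [← RingOfIntegers.coe_eq_algebraMap, ← hP, aeval_eq_sum_range' hPd, Finset.sum_range]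
  rw [map_mul, h1, Finset.mul_sum, map_sum, map_sum]
  refine Finset.sum_congr rfl fun m _ ↦ ?_
  have h2 : ((n m : ℚ) : K) = ((d * a : ℕ) * P.coeff m : ℚ) := by rw [hn]
  simp only [Algebra.smul_def, eq_ratCast, map_natCast, map_mul, aeval_C, map_pow, aeval_X, ht',
    ← mul_assoc]
  congr 1
  push_cast at h2
  simpa using h2.symm

theorem span_sub_ne_top (h : IsPureFieldGenerator d a A θ) {t : 𝓞 K} (ht : (t : K) = θ)
    {p : ℕ} (hp : p.Prime) (hpd : ¬ p ∣ d) {r : ℤ} (hpr : ¬ (p : ℤ) ∣ r)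
    (hr : (p : ℤ) ∣ r ^ d - a) : span {(p : 𝓞 K), t - r} ≠ ⊤ := by
  intro htop
  have hd : 0 < d := h.finrank_eq ▸ Module.finrank_pos
  obtain ⟨α, β, hαβ⟩ := mem_span_pair.1 ((eq_top_iff_one _).1 htop)
  obtain ⟨k, hk⟩ := hr
  set g : 𝓞 K := ∑ i ∈ Finset.range d, t ^ i * (r : 𝓞 K) ^ (d - 1 - i)
  have hg : g * (t - r) = -(p * k) := by
    rw [Commute.geom_sum₂_mul (Commute.all _ _)]
    have h1 : t ^ d = (a : 𝓞 K) := RingOfIntegers.coe_injective (by simp [ht, h.pow_eq])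
    have h2 : (r : 𝓞 K) ^ d - a = p * k := by exact_mod_cast congr_arg (Int.cast (R := 𝓞 K)) hk
    rw [h1, ← h2]
    ring
  have hgp : g = p * (α * g - β * k) := by
    calc g = g * (α * p + β * (t - r)) := by rw [hαβ, mul_one]
      _ = p * (α * g) + β * (g * (t - r)) := by ring
      _ = _ := by rw [hg]; ring
  set y := α * g - β * k
  have hp0 : (p : ℚ) ≠ 0 := Nat.cast_ne_zero.2 hp.ne_zero
  let P : ℚ[X] := ∑ i ∈ Finset.range d, C ((p : ℚ)⁻¹ * (r : ℚ) ^ (d - 1 - i)) * X ^ i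
  have hPd : P.natDegree < d := by
    rw [Nat.lt_iff_le_pred hd]
    exact natDegree_sum_le_of_forall_le _ _ fun i hi ↦ (natDegree_C_mul_X_pow_le _ _).trans
      (Nat.le_pred_of_lt (Finset.mem_range.1 hi))
  have hPy : aeval θ P = (y : K) := by
    have h1 : (g : K) = p * y := by
      rw [hgp]
      simp
    have hpK : (p : K) ≠ 0 := Nat.cast_ne_zero.2 hp.ne_zero
    rw [← inv_mul_eq_iff_eq_mul₀ hpK] at h1
    rw [← h1, RingOfIntegers.coe_eq_algebraMap, map_sum, map_sum, Finset.mul_sum]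
    refine Finset.sum_congr rfl fun i _ ↦ ?_
    simp [← ht]
    ring
  obtain ⟨n, hn⟩ := exists_int_eq_mul_coeff_of_le_one h hPd hd zero_le_one hPy
  have hc : P.coeff 0 = (p : ℚ)⁻¹ * (r : ℚ) ^ (d - 1) := by
    rw [coeff_zero_eq_eval_zero, eval_finsetSum, Finset.sum_eq_single_of_mem 0 (by simpa using hd)]
    · simp
    · intro i _ hi
      simp [hi]
  rw [hc] at hn
  have h3 : (p : ℤ) * n = d * r ^ (d - 1) := by
    have : (p : ℚ) * n = d * r ^ (d - 1) := by
      rw [hn]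
      field_simp
    exact_mod_cast this
  rcases (Nat.prime_iff_prime_int.1 hp).dvd_or_dvd (Dvd.intro _ h3) with h4 | h4
  · exact hpd (Int.natCast_dvd_natCast.1 h4)
  · exact hpr ((Nat.prime_iff_prime_int.1 hp).dvd_of_dvd_pow h4)

theorem absNorm_span_sub (h : IsPureFieldGenerator d a A θ) {t : 𝓞 K} (ht : (t : K) = θ)
    {p : ℕ} (hp : p.Prime) (hpd : ¬ p ∣ d) (hpa : ¬ p ∣ a) {r : ℤ} (hpr : ¬ (p : ℤ) ∣ r)
    (hr : (p : ℤ) ∣ r ^ d - a) : absNorm (span {(p : 𝓞 K), t - r}) = p := by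
  set I := span {(p : 𝓞 K), t - r}
  have : Fact p.Prime := ⟨hp⟩
  have : Nontrivial (𝓞 K ⧸ I) := Ideal.Quotient.nontrivial_iff.2 (span_sub_ne_top h ht hp hpd hpr hr)
  have hp0 : (p : 𝓞 K ⧸ I) = 0 := by
    rw [← map_natCast (Ideal.Quotient.mk I), Ideal.Quotient.eq_zero_iff_mem]
    exact subset_span (by simp)
  have : CharP (𝓞 K ⧸ I) p := (CharP.charP_iff_prime_eq_zero hp).2 hp0
  have htr : Ideal.Quotient.mk I t = (r : 𝓞 K ⧸ I) := by
    rw [← map_intCast (Ideal.Quotient.mk I), Ideal.Quotient.eq]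
    exact subset_span (by simp)
  let φ := ZMod.castHom (dvd_refl p) (𝓞 K ⧸ I)
  have hsurj : Function.Surjective φ := by
    intro y
    obtain ⟨x, rfl⟩ := Ideal.Quotient.mk_surjective y
    obtain ⟨Q, hQ⟩ := exists_int_mul_eq_aeval h ht x
    have hu : ((d * a : ℕ) : ZMod p) ≠ 0 := by
      rw [Ne, ZMod.natCast_eq_zero_iff, hp.dvd_mul]
      tauto
    refine ⟨((d * a : ℕ) : ZMod p)⁻¹ * ((Q.eval r : ℤ) : ZMod p), ?_⟩
    have h1 : φ ((Q.eval r : ℤ) : ZMod p) = φ ((d * a : ℕ) : ZMod p) * Ideal.Quotient.mk I x := by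
      rw [map_natCast, map_intCast, ← map_natCast (Ideal.Quotient.mk I), ← map_mul, hQ]
      have h2 : Ideal.Quotient.mk I (aeval t Q) = aeval (Ideal.Quotient.mk I t) Q :=
        (aeval_algHom_apply (Ideal.Quotient.mkₐ ℤ I) t Q).symm
      rw [h2, htr, ← eq_intCast (algebraMap ℤ (𝓞 K ⧸ I)) r, aeval_algebraMap_apply]
      simp
    rw [map_mul, h1, ← mul_assoc, ← map_mul, inv_mul_cancel₀ hu, map_one, one_mul]
  rw [absNorm_apply, Submodule.cardQuot_apply]
  exact (Nat.card_congr (Equiv.ofBijective φ ⟨φ.injective, hsurj⟩)).symm.trans (Nat.card_zmod p)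

theorem exists_pow_sub_dvd {p : ℕ} (hp : p.Prime) (hpd : (p - 1).Coprime d) (hpa : ¬ p ∣ a) :
    ∃ r : ℤ, ¬ (p : ℤ) ∣ r ∧ (p : ℤ) ∣ r ^ d - a := by
  have : Fact p.Prime := ⟨hp⟩
  have hcop : (Nat.card (ZMod p)ˣ).Coprime d := by
    rwa [Nat.card_eq_fintype_card, ZMod.card_units]
  have ha : (a : ZMod p) ≠ 0 := by rwa [Ne, ZMod.natCast_eq_zero_iff]
  obtain ⟨u, hu⟩ := (powCoprime hcop).surjective (Units.mk0 _ ha)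
  have hu' : (u : ZMod p) ^ d = a := by simpa using congr_arg Units.val hu
  refine ⟨((u : ZMod p).val : ℤ), ?_, ?_⟩
  · rw [← ZMod.intCast_zmod_eq_zero_iff_dvd]
    simp
  · rw [← ZMod.intCast_zmod_eq_zero_iff_dvd]
    simp [hu']

theorem ne_rat_mul_of_span_mul_eq (h : IsPureFieldGenerator d a A θ) (hd : 1 < d) {ℓ : ℕ}
    (hℓ : 0 < ℓ) {t : 𝓞 K} (ht : (t : K) = θ) {p q : ℕ} (hp : p.Prime) (hq : q.Prime)
    (hpq : p ≠ q) (hpd : ¬ p ∣ d) {r : ℤ} (hpr : ¬ (p : ℤ) ∣ r) {I J : Ideal (𝓞 K)}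
    (hI : absNorm I = p) (hJ : absNorm J = q) (htI : t - r ∈ I) {x y : 𝓞 K}
    (hy : y ≠ 0) (hxy : span {x} * J ^ ℓ = span {y} * I ^ ℓ) (b : ℚ) : (x : K) ≠ b * y := by
  intro hb
  have hyK : (y : K) ≠ 0 := by simpa using hy
  have hp0 : (p : ℚ) ≠ 0 := Nat.cast_ne_zero.2 hp.ne_zero
  have hq0 : (q : ℚ) ≠ 0 := Nat.cast_ne_zero.2 hq.ne_zero
  obtain ⟨z, hz⟩ : x ∣ y * (t - r) ^ ℓ := by
    rw [← mem_span_singleton]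
    have h1 : y * (t - r) ^ ℓ ∈ span {x} * J ^ ℓ := by
      rw [hxy]
      exact mul_mem_mul (mem_span_singleton_self y) (pow_mem_pow htI ℓ)
    exact mul_le_left h1
  have hz' : (θ - r) ^ ℓ = b * z := by
    have h1 := congr_arg (algebraMap (𝓞 K) K) hz
    simp only [map_mul, map_pow, map_sub, map_intCast, ht, hb] at h1
    refine mul_left_cancel₀ hyK ?_
    rw [h1]
    ring
  have hnorm : |b| ^ d * q ^ ℓ = p ^ ℓ := by
    have h1 := congr_arg absNorm hxy
    simp only [map_mul, map_pow, absNorm_span_singleton, hI, hJ] at h1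
    have h2 : ∀ u : 𝓞 K, (((Algebra.norm ℤ u).natAbs : ℕ) : ℚ) = |Algebra.norm ℚ (u : K)| :=
      fun u ↦ by rw [Nat.cast_natAbs, Int.cast_abs, Algebra.coe_norm_int]
    have h3 : |Algebra.norm ℚ (x : K)| * (q : ℚ) ^ ℓ = |Algebra.norm ℚ (y : K)| * (p : ℚ) ^ ℓ := by
      rw [← h2, ← h2]
      exact_mod_cast h1
    have h4 : Algebra.norm ℚ (x : K) = b ^ d * Algebra.norm ℚ (y : K) := by
      rw [hb, map_mul, ← eq_ratCast (algebraMap ℚ K), Algebra.norm_algebraMap, h.finrank_eq]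
    have h5 : |Algebra.norm ℚ (y : K)| ≠ 0 := abs_ne_zero.2 (Algebra.norm_ne_zero_iff.2 hyK)
    rw [h4, abs_mul, abs_pow] at h3
    refine mul_left_cancel₀ h5 ?_
    rw [← h3]
    ring
  set Y : K := q / p * (θ - r) ^ d with hY
  have hYint : IsIntegral ℤ Y := by
    refine IsIntegral.of_pow hℓ ?_
    have h1 : Y ^ ℓ = (q / p : K) ^ ℓ * (b : K) ^ d * (z : K) ^ d := by
      rw [hY, mul_pow, ← pow_mul, mul_comm d, pow_mul, hz', mul_pow]
      ring
    have h2 : |(q / p : ℚ) ^ ℓ * b ^ d| = 1 := by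
      rw [abs_mul, abs_pow b, div_pow, abs_of_nonneg (by positivity), div_mul_eq_mul_div,
        mul_comm, hnorm, div_self (pow_ne_zero _ hp0)]
    have h3 : (q / p : K) ^ ℓ * (b : K) ^ d = (((q / p : ℚ) ^ ℓ * b ^ d : ℚ) : K) := by
      push_cast
      rfl
    rw [h1, h3]
    refine IsIntegral.mul ?_ (z.isIntegral_coe.pow d)
    rcases eq_or_eq_neg_of_abs_eq h2 with h4 | h4 <;> rw [h4]
    · simpa using isIntegral_one
    · simpa using isIntegral_one.neg
  let P : ℚ[X] := C (q / p : ℚ) * ((X - C (r : ℚ)) ^ d - X ^ d + C (a : ℚ))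
  have hPd : P.natDegree < d := by
    have h1 : ((X - C (r : ℚ)) ^ d - X ^ d).degree < (d : WithBot ℕ) := by
      have hm : ((X - C (r : ℚ)) ^ d).Monic := (monic_X_sub_C _).pow d
      have hdeg : ((X - C (r : ℚ)) ^ d).degree = (d : WithBot ℕ) := by
        rw [degree_pow, degree_X_sub_C, nsmul_one]
      rw [← hdeg]
      exact degree_sub_lt_left (by rw [hdeg, degree_X_pow]) hm.ne_zero
        (by rw [hm.leadingCoeff, (monic_X_pow d).leadingCoeff])
    have h2 : ((X - C (r : ℚ)) ^ d - X ^ d + C (a : ℚ)).degree < (d : WithBot ℕ) :=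
      (degree_add_le _ _).trans_lt (max_lt h1 (degree_C_le.trans_lt (by exact_mod_cast by omega)))
    refine (natDegree_C_mul_le _ _).trans_lt ?_
    rcases eq_or_ne ((X - C (r : ℚ)) ^ d - X ^ d + C (a : ℚ)) 0 with h0 | h0
    · rw [h0, natDegree_zero]
      omega
    · exact (natDegree_lt_iff_degree_lt h0).2 h2
  obtain ⟨y', hy'⟩ : ∃ y' : 𝓞 K, (y' : K) = Y := ⟨⟨Y, hYint⟩, rfl⟩
  have hPY : aeval θ P = (y' : K) := by
    simp [P, h.pow_eq, hy', hY]
  obtain ⟨n, hn⟩ := exists_int_eq_mul_coeff_of_le_one h hPd hd le_rfl hPY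
  have hc : P.coeff 1 = (q / p * (d * (-r) ^ (d - 1)) : ℚ) := by
    have h1 : ((X - C (r : ℚ)) ^ d).coeff 1 = (d * (-r) ^ (d - 1) : ℚ) := by
      rw [sub_eq_add_neg, ← C_neg, coeff_X_add_C_pow, Nat.choose_one_right]
      ring
    rw [coeff_C_mul, coeff_add, coeff_sub, h1, coeff_X_pow, if_neg (by omega),
      coeff_C_of_ne_zero one_ne_zero]
    ring
  rw [hc] at hn
  have h3 : (p : ℤ) * n = d * (q * (d * (-r) ^ (d - 1))) := by
    have : (p : ℚ) * n = d * (q * (d * (-r) ^ (d - 1))) := by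
      rw [hn]
      field_simp
    exact_mod_cast this
  have hp' := Nat.prime_iff_prime_int.1 hp
  have hpd' : ¬ (p : ℤ) ∣ d := fun h4 ↦ hpd (Int.natCast_dvd_natCast.1 h4)
  have hpq' : ¬ (p : ℤ) ∣ q := fun h4 ↦
    hpq ((Nat.prime_dvd_prime_iff_eq hp hq).1 (Int.natCast_dvd_natCast.1 h4))
  have hpr' : ¬ (p : ℤ) ∣ (-r) ^ (d - 1) := fun h4 ↦ hpr ((dvd_neg).1 (hp'.dvd_of_dvd_pow h4))
  have := Dvd.intro _ h3
  rw [hp'.dvd_mul, hp'.dvd_mul, hp'.dvd_mul] at this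
  tauto

theorem exists_integral_mul_pow_absNorm {ℓ : ℕ} {I J : Ideal (𝓞 K)} {x y : 𝓞 K}
    (hxy : span {x} * J ^ ℓ = span {y} * I ^ ℓ) :
    ∃ γ : 𝓞 K, x * (absNorm J : 𝓞 K) ^ ℓ = y * γ := by
  have h1 : x * (absNorm J : 𝓞 K) ^ ℓ ∈ span {y} * I ^ ℓ := by
    rw [← hxy]
    exact mul_mem_mul (mem_span_singleton_self x) (pow_mem_pow (absNorm_mem J) ℓ)
  exact mem_span_singleton.1 (mul_le_left h1)

theorem not_forall_infinitePlace_mul_le (h : IsPureFieldGenerator d a A θ) (hodd : Odd d)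
    (hd : 1 < d) {ℓ : ℕ}
    (hℓ : 0 < ℓ) {t : 𝓞 K} (ht : (t : K) = θ) {p q : ℕ} (hp : p.Prime) (hq : q.Prime)
    (hpq : p ≠ q) (hpd : ¬ p ∣ d) {r : ℤ} (hpr : ¬ (p : ℤ) ∣ r) {I J : Ideal (𝓞 K)}
    (hI : absNorm I = p) (hJ : absNorm J = q) (htI : t - r ∈ I) {x y : 𝓞 K}
    (hx : x ≠ 0) (hy : y ≠ 0) (hxy : span {x} * J ^ ℓ = span {y} * I ^ ℓ) {B : ℝ} (hB0 : 0 ≤ B)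
    (hB : ∀ m, (d + 1) / 2 ≤ m → m ≤ d - 1 → d * B < fractProd A d m) :
    ¬ ∀ w : InfinitePlace K, w x * absNorm J ^ ℓ ≤ B * w y ∧
      w y * absNorm I ^ ℓ ≤ B * w x := by
  intro hw
  have hxK : (x : K) ≠ 0 := by simpa using hx
  have hyK : (y : K) ≠ 0 := by simpa using hy
  obtain ⟨γ, hγ⟩ := exists_integral_mul_pow_absNorm hxy
  obtain ⟨γ', hγ'⟩ := exists_integral_mul_pow_absNorm hxy.symm
  have hγK : (x : K) * (absNorm J : K) ^ ℓ = y * γ := by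
    simpa using congr_arg (algebraMap (𝓞 K) K) hγ
  have hγK' : (y : K) * (absNorm I : K) ^ ℓ = x * γ' := by
    simpa using congr_arg (algebraMap (𝓞 K) K) hγ'
  have hnat : ∀ (w : InfinitePlace K) (n : ℕ), w (n : K) = n := fun w n ↦ by
    rw [← InfinitePlace.norm_embedding_eq, map_natCast]
    simp
  have key : (γ : K) * γ' = ((((absNorm J) ^ ℓ * (absNorm I) ^ ℓ : ℕ) : ℚ) : K) := by
    refine mul_left_cancel₀ (mul_ne_zero hxK hyK) ?_
    push_cast
    calc (x : K) * y * (γ * γ') = (y * γ) * (x * γ') := by ring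
      _ = _ := by rw [← hγK, ← hγK']; ring
  have hIJ : (((absNorm J) ^ ℓ * (absNorm I) ^ ℓ : ℕ) : ℚ) ≠ 0 := by
    rw [hI, hJ, Nat.cast_ne_zero]
    exact mul_ne_zero (pow_ne_zero _ hq.ne_zero) (pow_ne_zero _ hp.ne_zero)
  have hle : ∀ w : InfinitePlace K, w (γ : K) ≤ B := fun w ↦ by
    have h1 := congr_arg w hγK
    simp only [map_mul, map_pow, hnat] at h1
    refine le_of_mul_le_mul_left ?_ (w.pos_iff.2 hyK)
    rw [← h1, mul_comm (w (y : K))]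
    exact (hw w).1
  have hle' : ∀ w : InfinitePlace K, w (γ' : K) ≤ B := fun w ↦ by
    have h1 := congr_arg w hγK'
    simp only [map_mul, map_pow, hnat] at h1
    refine le_of_mul_le_mul_left ?_ (w.pos_iff.2 hxK)
    rw [← h1, mul_comm (w (x : K))]
    exact (hw w).2
  obtain ⟨c, hc⟩ := exists_rat_eq_of_mul_eq h hodd hB0 hB hIJ key hle hle'
  refine ne_rat_mul_of_span_mul_eq h hd hℓ ht hp hq hpq hpd hpr hI hJ htI hy hxy
    (c / (q : ℚ) ^ ℓ) ?_
  have hqK : (q : K) ^ ℓ ≠ 0 := pow_ne_zero _ (Nat.cast_ne_zero.2 hq.ne_zero)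
  push_cast
  rw [← hc, div_mul_eq_mul_div, eq_div_iff hqK, ← hJ, hγK, mul_comm]

end PurePrimes

section TorsionBound

open Ideal

theorem card_primeFactors_le_two_mul_log {a : ℕ} (ha : a ≠ 0) :
    (a.primeFactors.card : ℝ) ≤ 2 * Real.log a := by
  have h1 : 2 ^ a.primeFactors.card ≤ a :=
    (Finset.pow_card_le_prod _ _ _ fun p hp ↦ (Nat.prime_of_mem_primeFactors hp).two_le).trans
      (Nat.le_of_dvd (Nat.pos_of_ne_zero ha) (Nat.prod_primeFactors_dvd a))
  have h2 : (a.primeFactors.card : ℝ) * Real.log 2 ≤ Real.log a := by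
    rw [← Real.log_pow]
    exact Real.log_le_log (by positivity) (by exact_mod_cast h1)
  have h3 : (0 : ℝ) ≤ a.primeFactors.card := Nat.cast_nonneg _
  nlinarith [Real.log_two_gt_d9]

theorem one_add_log_le {x δ : ℝ} (hx : 1 ≤ x) (hδ : 0 < δ) :
    1 + Real.log x ≤ (1 + 1 / δ) * x ^ δ := by
  have h1 := Real.log_le_rpow_div (zero_le_one.trans hx) hδ
  have h2 := Real.one_le_rpow hx hδ.le
  calc 1 + Real.log x ≤ x ^ δ + x ^ δ / δ := add_le_add h2 h1
    _ = _ := by ring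

section Field

variable {K : Type*} [Field K] [NumberField K] {d a : ℕ} {A : ℕ → ℕ} {θ : K}

theorem card_torsion_mul_card_add_one_le (h : IsPureFieldGenerator d a A θ) (hodd : Odd d)
    (hd : 1 < d) {ℓ : ℕ} (hℓ : 0 < ℓ) {Z : ℝ} (hZ0 : 0 ≤ Z)
    (hZ : ∀ m, (d + 1) / 2 ≤ m → m ≤ d - 1 → d * (Real.exp 1 ^ ℓ * Z ^ ℓ) < fractProd A d m)
    {R : Finset ℕ} (hR : ∀ p ∈ R, p.Prime ∧ (p : ℝ) ≤ Z ∧ ¬ p ∣ d ∧ ¬ p ∣ a ∧ (p - 1).Coprime d)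
    {B : ℝ} (hB1 : 1 ≤ B) (hB : 2 ^ d * √|discr K| < B ^ d)
    (T : Finset (Ideal (𝓞 K))) (hT : ∀ I, I ≠ ⊥ → (absNorm I : ℝ) ≤ B ^ d → I ∈ T) :
    Nat.card {c : ClassGroup (𝓞 K) // c ^ ℓ = 1} * (R.card + 1) ≤
      2 * (T.card * (⌊Real.log (B ^ d)⌋₊ + 1) ^ d) := by
  classical
  obtain ⟨t, ht⟩ := h.exists_ringOfIntegers_coe_eq
  have hex : ∀ p : R, ∃ (r : ℤ) (I : Ideal (𝓞 K)), ¬ ((p : ℕ) : ℤ) ∣ r ∧ t - r ∈ I ∧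
      absNorm I = p := by
    rintro ⟨p, hp⟩
    obtain ⟨hp, -, hpd, hpa, hcop⟩ := hR p hp
    obtain ⟨r, hpr, hr⟩ := exists_pow_sub_dvd hp hcop hpa
    exact ⟨r, _, hpr, subset_span (by simp), absNorm_span_sub h ht hp hpd hpa hpr hr⟩
  choose r I hr hI hnorm using hex
  have hinj : Function.Injective I := fun p q hpq ↦
    Subtype.ext (by rw [← hnorm, ← hnorm, hpq])
  obtain rfl := h.finrank_eq
  have h1 := card_torsion_mul_card_le hℓ hB1 hB (Finset.univ.image I) (Z := Z)
    (by
      simp only [Finset.mem_image, Finset.mem_univ, true_and, forall_exists_index,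
        forall_apply_eq_imp_iff]
      intro p hp
      have := hnorm p
      rw [hp, absNorm_bot] at this
      exact (hR p p.2).1.ne_zero this.symm)
    (by
      simp only [Finset.mem_image, Finset.mem_univ, true_and, forall_exists_index,
        forall_apply_eq_imp_iff]
      intro p
      rw [hnorm]
      exact (hR p p.2).2.1)
    (by
      simp only [Finset.mem_image, Finset.mem_univ, true_and, forall_exists_index,
        forall_apply_eq_imp_iff]
      intro p q hpq x y hx hy hxy
      exact not_forall_infinitePlace_mul_le h hodd hd hℓ ht (hR p p.2).1 (hR q q.2).1
        (fun h ↦ hpq (congr_arg I (Subtype.ext h))) (hR p p.2).2.2.1 (hr p) (hnorm p) (hnorm q)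
        (hI p) hx hy hxy (by positivity) hZ)
    T hT
  have h2 := card_torsion_mul_card_le hℓ hB1 hB {⊤} (Z := 1) (by simp) (by simp) (by simp) T hT
  rw [Finset.card_image_of_injective _ hinj, Finset.card_univ, Fintype.card_coe] at h1
  rw [Finset.card_singleton] at h2
  linarith

end Field

theorem coprime_and_not_dvd_of_cast_eq_two {d p : ℕ} (hodd : Odd d) (hp : p.Prime)
    (h : (p : ZMod d) = 2) : ¬ p ∣ d ∧ (p - 1).Coprime d := by
  have hmod : p ≡ 2 [MOD d] := (ZMod.natCast_eq_natCast_iff p 2 d).1 (by simpa using h)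
  constructor
  · intro hpd
    have h2 : p ∣ 2 := (Nat.modEq_zero_iff_dvd).1
      (((hmod.of_dvd hpd).symm).trans ((Nat.modEq_zero_iff_dvd).2 dvd_rfl))
    obtain rfl := (Nat.prime_dvd_prime_iff_eq hp Nat.prime_two).1 h2
    exact (Nat.not_even_iff_odd.2 hodd) (even_iff_two_dvd.2 hpd)
  · have h1 : p - 1 ≡ 1 [MOD d] := by
      refine Nat.ModEq.add_right_cancel' 1 ?_
      rwa [Nat.sub_add_cancel hp.one_le]
    exact (h1.gcd_eq).trans (Nat.gcd_one_left d)

theorem exists_card_torsion_le_fractProd (d ℓ : ℕ) (hd : 1 < d) (hodd : Odd d) (hℓ : 0 < ℓ)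
    {δ : ℝ} (hδ : 0 < δ) (hδ1 : δ < 1) :
    ∃ C : ℝ, 0 < C ∧ ∀ (K : Type) [Field K] [NumberField K] (a : ℕ) (A : ℕ → ℕ) (θ : K),
      IsPureFieldGenerator d a A θ → ∀ X : ℝ, 1 ≤ X → X ≤ a →
      (∀ m, (d + 1) / 2 ≤ m → m ≤ d - 1 → X ≤ fractProd A d m) →
      Nat.card {c : ClassGroup (𝓞 K) // c ^ ℓ = 1} * X ^ (1 / (ℓ : ℝ)) ≤
        C * (1 + Real.log a) * a ^ δ * (2 ^ d * √|discr K| + 1) ^ (1 + δ) *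
          (1 + Real.log (2 ^ d * √|discr K| + 1)) ^ d := by
  have : NeZero d := ⟨by omega⟩
  have hunit : IsUnit (2 : ZMod d) := by
    have := (ZMod.isUnit_iff_coprime 2 d).2 (Nat.coprime_two_left.2 hodd)
    simpa using this
  obtain ⟨c, hc0, hc⟩ := exists_le_card_primes_residueClass hunit hδ hδ1
  obtain ⟨C, hC0, hC⟩ := exists_card_ideal_absNorm_le d hδ
  set κ : ℝ := (2 * d * Real.exp 1 ^ ℓ)⁻¹ ^ (1 / (ℓ : ℝ)) with hκ
  have hκ0 : 0 < κ := by positivity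
  refine ⟨2 * C * 2 / (c * κ ^ (1 - δ)), by positivity, fun K _ _ a A θ h X hX1 hXa hX ↦ ?_⟩
  have hX0 : 0 < X := one_pos.trans_le hX1
  have ha1 : (1 : ℝ) ≤ a := hX1.trans hXa
  have hℓ0 : (ℓ : ℝ) ≠ 0 := Nat.cast_ne_zero.2 hℓ.ne'
  set W : ℝ := 2 ^ d * √|discr K| + 1 with hW
  have hW1 : 1 ≤ W := le_add_of_nonneg_left (by positivity)
  set Z : ℝ := κ * X ^ (1 / (ℓ : ℝ)) with hZ
  have hZ0 : 0 < Z := by positivity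
  have hZℓ : d * (Real.exp 1 ^ ℓ * Z ^ ℓ) = X / 2 := by
    have h1 : ∀ y : ℝ, 0 ≤ y → (y ^ (1 / (ℓ : ℝ))) ^ ℓ = y := fun y hy ↦ by
      rw [one_div, Real.rpow_inv_natCast_pow hy hℓ.ne']
    rw [hZ, mul_pow, hκ, h1 _ (by positivity), h1 _ hX0.le]
    field_simp
  set F := (Finset.range (⌊Z⌋₊ + 1)).filter fun p : ℕ ↦ p.Prime ∧ (p : ZMod d) = 2 with hF
  set R := F \ a.primeFactors with hR
  have hRprop : ∀ p ∈ R, p.Prime ∧ (p : ℝ) ≤ Z ∧ ¬ p ∣ d ∧ ¬ p ∣ a ∧ (p - 1).Coprime d := by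
    intro p hp
    rw [hR, Finset.mem_sdiff, hF, Finset.mem_filter, Finset.mem_range, Nat.lt_succ_iff,
      Nat.le_floor_iff hZ0.le, Nat.mem_primeFactors_of_ne_zero h.ne_zero] at hp
    obtain ⟨⟨hpZ, hp, hp2⟩, hpa⟩ := hp
    obtain ⟨h1, h2⟩ := coprime_and_not_dvd_of_cast_eq_two hodd hp hp2
    exact ⟨hp, hpZ, h1, fun h ↦ hpa ⟨hp, h⟩, h2⟩
  have hRcard : c * Z ^ (1 - δ) ≤ (R.card + 1) * (2 * (1 + Real.log a)) := by
    have h1 := hc Z hZ0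
    have h2 : (F.card : ℝ) ≤ R.card + a.primeFactors.card := by
      exact_mod_cast Finset.card_le_card_sdiff_add_card
    have h3 := card_primeFactors_le_two_mul_log h.ne_zero
    have h4 : (0 : ℝ) ≤ R.card := Nat.cast_nonneg _
    have h5 := Real.log_nonneg ha1
    nlinarith [mul_nonneg h4 h5]
  have hfin : {I : Ideal (𝓞 K) | I ≠ ⊥ ∧ (absNorm I : ℝ) ≤ W}.Finite :=
    (finite_setOfPred_absNorm_le ⌊W⌋₊).subset fun I hI ↦ Nat.le_floor hI.2
  obtain ⟨B, hB1, hBW⟩ : ∃ B : ℝ, 1 ≤ B ∧ B ^ d = W :=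
    ⟨W ^ (d : ℝ)⁻¹, Real.one_le_rpow hW1 (by positivity),
      Real.rpow_inv_natCast_pow (by positivity) (by omega)⟩
  have hcard := card_torsion_mul_card_add_one_le h hodd hd hℓ hZ0.le
    (fun m hm hm' ↦ by rw [hZℓ]; linarith [hX m hm hm']) hRprop hB1
    (by rw [hBW]; exact lt_add_one _) hfin.toFinset (fun I h0 hle ↦ by
      rw [hBW] at hle
      simpa using And.intro h0 hle)
  rw [hBW] at hcard
  have hTcard := hC K h.finrank_eq W (by positivity) hfin.toFinset (fun I hI ↦ by simpa using hI)
  set N := Nat.card {c : ClassGroup (𝓞 K) // c ^ ℓ = 1}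
  have hcard' : (N : ℝ) * (R.card + 1) ≤ 2 * (C * W ^ (1 + δ) * (1 + Real.log W) ^ d) := by
    calc (N : ℝ) * (R.card + 1) ≤ 2 * (hfin.toFinset.card * (⌊Real.log W⌋₊ + 1) ^ d) := by
          exact_mod_cast hcard
      _ ≤ 2 * (C * W ^ (1 + δ) * (1 + Real.log W) ^ d) := by
        have := Nat.floor_le (Real.log_nonneg hW1)
        have e : (⌊Real.log W⌋₊ : ℝ) + 1 ≤ 1 + Real.log W := by linarith
        exact mul_le_mul_of_nonneg_left (mul_le_mul hTcard (pow_le_pow_left₀ (by positivity) e d)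
          (by positivity) (by positivity)) (by norm_num)
  have hZδ : Z ^ (1 - δ) * a ^ δ ≥ κ ^ (1 - δ) * X ^ (1 / (ℓ : ℝ)) := by
    have h1 : X ^ (1 / (ℓ : ℝ)) ≤ X ^ (1 / (ℓ : ℝ) * (1 - δ)) * a ^ δ := by
      calc X ^ (1 / (ℓ : ℝ)) = X ^ (1 / (ℓ : ℝ) * (1 - δ)) * X ^ (1 / (ℓ : ℝ) * δ) := by
            rw [← Real.rpow_add hX0]
            ring_nf
        _ ≤ X ^ (1 / (ℓ : ℝ) * (1 - δ)) * X ^ δ := by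
          have h2 : 1 / (ℓ : ℝ) ≤ 1 :=
            (div_le_one (by positivity)).2 (Nat.one_le_cast.2 hℓ)
          gcongr
          exact mul_le_of_le_one_left hδ.le h2
        _ ≤ _ := by gcongr
    rw [hZ, Real.mul_rpow hκ0.le (by positivity), ← Real.rpow_mul hX0.le, mul_assoc]
    gcongr
  have hlog := Real.log_nonneg ha1
  have hlogW := Real.log_nonneg hW1
  rw [div_mul_eq_mul_div, div_mul_eq_mul_div, div_mul_eq_mul_div, div_mul_eq_mul_div,
    le_div_iff₀ (by positivity)]
  calc N * X ^ (1 / (ℓ : ℝ)) * (c * κ ^ (1 - δ))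
      = N * c * (κ ^ (1 - δ) * X ^ (1 / (ℓ : ℝ))) := by ring
    _ ≤ N * c * (Z ^ (1 - δ) * a ^ δ) := by gcongr
    _ = N * (c * Z ^ (1 - δ)) * a ^ δ := by ring
    _ ≤ N * ((R.card + 1) * (2 * (1 + Real.log a))) * a ^ δ := by gcongr
    _ = N * (R.card + 1) * (2 * (1 + Real.log a)) * a ^ δ := by ring
    _ ≤ 2 * (C * W ^ (1 + δ) * (1 + Real.log W) ^ d) * (2 * (1 + Real.log a)) * a ^ δ := by gcongr
    _ = _ := by ring

/-- Absorption of the logarithms and of small powers of `a` when `a` is polynomially bounded. -/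
theorem exists_mul_log_mul_rpow_le (d : ℕ) (hd : 1 < d) {ε : ℝ} (hε : 0 < ε) :
    ∃ δ : ℝ, 0 < δ ∧ δ < 1 ∧ ∃ C : ℝ, 0 < C ∧ ∀ a D : ℝ, 1 ≤ a → 1 ≤ D →
      a ≤ (d * (2 ^ d * √D + 1) ^ (d - 1)) ^ d →
      (1 + Real.log a) * a ^ δ * (2 ^ d * √D + 1) ^ (1 + δ) *
        (1 + Real.log (2 ^ d * √D + 1)) ^ d ≤ C * D ^ (1 / 2 + ε) := by
  have hd0 : (0 : ℝ) < d := Nat.cast_pos.2 (by omega)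
  set δ : ℝ := min (1 / 2) (ε / (4 * d ^ 2)) with hδ
  have hδ0 : 0 < δ := lt_min (by norm_num) (by positivity)
  have hδd : δ * (4 * d ^ 2) ≤ ε := (le_div_iff₀ (by positivity)).1 (min_le_right _ _)
  have hδε : δ ≤ ε / 2 := by
    have : (1 : ℝ) ≤ d ^ 2 := one_le_pow₀ (Nat.one_le_cast.2 hd.le)
    nlinarith
  set η : ℝ := ε / d with hη
  have hη0 : 0 < η := by positivity
  refine ⟨δ, hδ0, (min_le_left _ _).trans_lt (by norm_num),
    (1 + 1 / δ) * ((d : ℝ) ^ d) ^ (2 * δ) * (1 + 1 / η) ^ d * (2 ^ (d + 1)) ^ (1 + 2 * ε),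
    by positivity, fun a D ha hD hle ↦ ?_⟩
  have hD0 : 0 < D := one_pos.trans_le hD
  set W := 2 ^ d * √D + 1 with hW
  have hW1 : 1 ≤ W := le_add_of_nonneg_left (by positivity)
  have hW0 : 0 < W := one_pos.trans_le hW1
  have ha0 : 0 < a := one_pos.trans_le ha
  have hWle : W ≤ 2 ^ (d + 1) * √D := by
    have h1 : 1 ≤ √D := Real.one_le_sqrt.2 hD
    have h2 : (1 : ℝ) ≤ 2 ^ d := one_le_pow₀ one_le_two
    rw [hW, pow_succ]
    nlinarith
  have h1 : (1 + Real.log a) * a ^ δ ≤ (1 + 1 / δ) * (((d : ℝ) ^ d) ^ (2 * δ) * W ^ (ε / 2)) := by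
    calc (1 + Real.log a) * a ^ δ ≤ (1 + 1 / δ) * a ^ δ * a ^ δ := by
          gcongr
          exact one_add_log_le ha hδ0
      _ = (1 + 1 / δ) * a ^ (2 * δ) := by
        rw [mul_assoc, ← Real.rpow_add ha0, two_mul]
      _ ≤ (1 + 1 / δ) * ((d : ℝ) ^ d * W ^ (d ^ 2)) ^ (2 * δ) := by
        gcongr
        refine hle.trans ?_
        rw [mul_pow, ← pow_mul]
        gcongr
        rw [sq]
        exact Nat.mul_le_mul_right d (Nat.sub_le d 1)
      _ ≤ _ := by
        rw [Real.mul_rpow (by positivity) (by positivity), ← Real.rpow_natCast W,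
          ← Real.rpow_mul hW0.le]
        gcongr
        push_cast
        linarith
  have h2 : (1 + Real.log W) ^ d ≤ (1 + 1 / η) ^ d * W ^ ε := by
    calc (1 + Real.log W) ^ d ≤ ((1 + 1 / η) * W ^ η) ^ d := by
          have := Real.log_nonneg hW1
          gcongr
          exact one_add_log_le hW1 hη0
      _ = _ := by
        rw [mul_pow, ← Real.rpow_natCast (W ^ η), ← Real.rpow_mul hW0.le, hη,
          div_mul_cancel₀ _ hd0.ne']
  have h3 : W ^ (1 + 2 * ε) ≤ (2 ^ (d + 1)) ^ (1 + 2 * ε) * D ^ (1 / 2 + ε) := by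
    calc W ^ (1 + 2 * ε) ≤ (2 ^ (d + 1) * √D) ^ (1 + 2 * ε) := by gcongr
      _ = _ := by
        rw [Real.mul_rpow (by positivity) (by positivity), Real.sqrt_eq_rpow,
          ← Real.rpow_mul hD0.le]
        ring_nf
  have h4 : W ^ (1 + δ) ≤ W ^ (1 + ε / 2) := Real.rpow_le_rpow_of_exponent_le hW1 (by linarith)
  calc (1 + Real.log a) * a ^ δ * W ^ (1 + δ) * (1 + Real.log W) ^ d
      ≤ (1 + 1 / δ) * (((d : ℝ) ^ d) ^ (2 * δ) * W ^ (ε / 2)) * W ^ (1 + ε / 2) *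
        ((1 + 1 / η) ^ d * W ^ ε) := by
        have := Real.log_nonneg ha
        have := Real.log_nonneg hW1
        gcongr
    _ = (1 + 1 / δ) * ((d : ℝ) ^ d) ^ (2 * δ) * (1 + 1 / η) ^ d *
        (W ^ (ε / 2) * W ^ (1 + ε / 2) * W ^ ε) := by ring
    _ = (1 + 1 / δ) * ((d : ℝ) ^ d) ^ (2 * δ) * (1 + 1 / η) ^ d * W ^ (1 + 2 * ε) := by
      rw [← Real.rpow_add hW0, ← Real.rpow_add hW0]
      ring_nf
    _ ≤ (1 + 1 / δ) * ((d : ℝ) ^ d) ^ (2 * δ) * (1 + 1 / η) ^ d *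
        ((2 ^ (d + 1)) ^ (1 + 2 * ε) * D ^ (1 / 2 + ε)) := by gcongr
    _ = _ := by ring

end TorsionBound

/-- torsion bound for pure fields of odd degree `d` (Proposition `prop:GB`). -/
theorem torsion_pure_field_odd (d ℓ : ℕ) (hd3 : 3 ≤ d) (hodd : Odd d) (hℓ : 0 < ℓ)
    (ε : ℝ) (hε : 0 < ε) :
    ∃ C : ℝ, 0 < C ∧
      ∀ (K : Type) (_ : Field K) (_ : NumberField K) (a : ℕ) (A : ℕ → ℕ) (θ : K),
        (∀ i ∈ Finset.Icc 1 (d - 1), Squarefree (A i) ∧ 0 < A i) →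
        (∀ i ∈ Finset.Icc 1 (d - 1), ∀ j ∈ Finset.Icc 1 (d - 1), i ≠ j →
          Nat.Coprime (A i) (A j)) →
        a = ∏ i ∈ Finset.Icc 1 (d - 1), A i ^ i → 1 < a →
        θ ^ d = (a : K) → IntermediateField.adjoin ℚ {θ} = ⊤ →
        Module.finrank ℚ K = d →
        (Nat.card {c : ClassGroup (𝓞 K) // c ^ ℓ = 1} : ℝ) ≤
          C * (DK K : ℝ) ^ ((1 : ℝ) / 2 + ε) *
            (sInf {x : ℝ | ∃ m : ℕ, (d + 1) / 2 ≤ m ∧ m ≤ d - 1 ∧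
                x = ∏ i ∈ Finset.Icc 1 (d - 1),
                  (A i : ℝ) ^ (((i * m : ℕ) : ℝ) / (d : ℝ) - (((i * m) / d : ℕ) : ℝ))}) ^
              (-(1 : ℝ) / (ℓ : ℝ)) := by
  obtain ⟨δ, hδ0, hδ1, C₁, hC₁0, hC₁⟩ := exists_mul_log_mul_rpow_le d (by omega) hε
  obtain ⟨C₂, hC₂0, hC₂⟩ := exists_card_torsion_le_fractProd d ℓ (by omega) hodd hℓ hδ0 hδ1
  refine ⟨C₂ * C₁, by positivity, fun K _ _ a A θ hsq hcop ha ha1 hθ htop hfin ↦ ?_⟩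
  have h : IsPureFieldGenerator d a A θ := ⟨hsq, hcop, ha, hθ, htop, hfin⟩
  set s : Set ℝ := {x : ℝ | ∃ m : ℕ, (d + 1) / 2 ≤ m ∧ m ≤ d - 1 ∧
    x = ∏ i ∈ Finset.Icc 1 (d - 1),
      (A i : ℝ) ^ (((i * m : ℕ) : ℝ) / (d : ℝ) - (((i * m) / d : ℕ) : ℝ))}
  have hmem : ∀ m, (d + 1) / 2 ≤ m → m ≤ d - 1 → fractProd A d m ∈ s :=
    fun m hm hm' ↦ ⟨m, hm, hm', rfl⟩
  have hlb : ∀ x ∈ s, 1 ≤ x := by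
    rintro x ⟨m, -, -, rfl⟩
    exact h.one_le_fractProd m
  have hne : fractProd A d (d - 1) ∈ s := hmem _ (by omega) le_rfl
  have hX1 : 1 ≤ sInf s := le_csInf ⟨_, hne⟩ hlb
  have hinf : ∀ x ∈ s, sInf s ≤ x := fun x hx ↦ csInf_le ⟨1, hlb⟩ hx
  have hD : (DK K : ℝ) = |(discr K : ℝ)| := by
    rw [DK, Nat.cast_natAbs, Int.cast_abs]
  have hD1 : 1 ≤ |(discr K : ℝ)| := by
    exact_mod_cast Int.one_le_abs (discr_ne_zero K)
  have key := (hC₂ K a A θ h (sInf s) hX1 ((hinf _ hne).trans (h.fractProd_le _))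
    fun m hm hm' ↦ hinf _ (hmem m hm hm'))
  have habs := hC₁ a |(discr K : ℝ)| (by exact_mod_cast ha1.le) hD1 (h.le_discr hodd (by omega))
  have hX0 : 0 < sInf s := one_pos.trans_le hX1
  rw [hD, neg_div, Real.rpow_neg hX0.le, ← div_eq_mul_inv, le_div_iff₀ (by positivity)]
  refine key.trans ?_
  rw [mul_assoc C₂ C₁]
  refine le_trans (le_of_eq ?_) (mul_le_mul_of_nonneg_left habs hC₂0.le)
  ring
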